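/- arXiv:2107.03495 — 2 statements merged into one kernel-verified Lean document; each statement's English description precedes it below -/
import Mathlib

section
/- Key comparison estimate for eigenfunctions of nested domains: Fix n ≥ 2, v_max > 0, α > 0 and λ₀ > 0. There is a constant C = C(n, α, v_max, λ₀) such that the following holds. Let Ω ⊆ Ω′ ⊆ ℝ^n be nonempty bounded open sets with |Ω′| ≤ v_max and λ₁(Ω) ≤ λ₀. Let u′ be a normalized first eigenfunction of Ω′, and assume the spectral gap condition: ∫|∇v|² ≥ (λ₁(Ω′) + α)·∫v² for every v ∈ H¹₀(Ω′) with ∫ v u′ = 0. Let u be any normalized first eigenfunction of Ω, and let f : ℝ^n → ℝ be bounded and measurable. Then |∫ f·(u′ − u)| ≤ C·‖f‖_{L^∞}·( tor(Ω) − tor(Ω′) + λ₁(Ω) − λ₁(Ω′) ). -/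
open MeasureTheory Metric Set Filter Bornology
open scoped ENNReal NNReal Topology

noncomputable section

abbrev Euc (n : ℕ) := EuclideanSpace ℝ (Fin n)

/-- A smooth test function compactly supported in `Ω`. -/
def IsTestFun {n : ℕ} (Ω : Set (Euc n)) (φ : Euc n → ℝ) : Prop :=
  ContDiff ℝ (⊤ : ℕ∞) φ ∧ HasCompactSupport φ ∧ tsupport φ ⊆ Ω

/-- `u` belongs to `H¹₀(Ω)` with weak gradient `Du`: it is an `L²` limit of smooth
functions compactly supported in `Ω` whose gradients converge to `Du` in `L²`. -/
def MemH10 {n : ℕ} (Ω : Set (Euc n)) (u : Euc n → ℝ) (Du : Euc n → Euc n) : Prop :=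
  MemLp u 2 volume ∧ MemLp Du 2 volume ∧
  ∃ φ : ℕ → Euc n → ℝ, (∀ k, IsTestFun Ω (φ k)) ∧
    Tendsto (fun k => ∫ x, (φ k x - u x) ^ 2) atTop (𝓝 0) ∧
    Tendsto (fun k => ∫ x, ‖gradient (φ k) x - Du x‖ ^ 2) atTop (𝓝 0)

/-- First Dirichlet eigenvalue: infimum of the Rayleigh quotient over `H¹₀(Ω)`. -/
def lam1 {n : ℕ} (Ω : Set (Euc n)) : ℝ :=
  sInf {r | ∃ u Du, MemH10 Ω u Du ∧ (∫ x, u x ^ 2) ≠ 0 ∧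
    r = (∫ x, ‖Du x‖ ^ 2) / (∫ x, u x ^ 2)}

/-- Torsional rigidity: `tor Ω = inf { ∫ (½|∇w|² − w) : w ∈ H¹₀(Ω) }`. -/
def tor {n : ℕ} (Ω : Set (Euc n)) : ℝ :=
  sInf {r | ∃ w Dw, MemH10 Ω w Dw ∧ r = ∫ x, ((1 / 2) * ‖Dw x‖ ^ 2 - w x)}

/-- Normalized first eigenfunction of `Ω`, extended by zero outside `Ω`. -/
def IsEigenfun {n : ℕ} (Ω : Set (Euc n)) (u : Euc n → ℝ) : Prop :=
  (∀ᵐ x ∂volume, 0 ≤ u x) ∧ (∀ x ∉ Ω, u x = 0) ∧ (∫ x, u x ^ 2) = 1 ∧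
  ∃ Du, MemH10 Ω u Du ∧ (∫ x, ‖Du x‖ ^ 2) = lam1 Ω

section

variable {n : ℕ}


lemma exists_p (ε : ℝ) (hε : 0 < ε) : ∃ p : ℝ → ℝ, ContDiff ℝ (⊤ : ℕ∞) p ∧ (∀ s ≤ 0, p s = 0) ∧
    (∀ s, 0 ≤ deriv p s) ∧ (∀ s, deriv p s ≤ 1) ∧ (∀ s, s - ε ≤ p s) ∧ (∀ s, 0 ≤ p s) ∧
    (∀ s, p s ≤ max s 0) := by
  have hst : Continuous (fun r : ℝ => Real.smoothTransition (r / ε)) :=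
    Real.smoothTransition.continuous.comp (by fun_prop)
  have hint : ∀ a b : ℝ, IntervalIntegrable (fun r : ℝ => Real.smoothTransition (r / ε)) volume a b :=
    fun a b => hst.intervalIntegrable a b
  set p : ℝ → ℝ := fun s => ∫ r in (0:ℝ)..s, Real.smoothTransition (r / ε) with hp
  have hd : ∀ s, HasDerivAt p (Real.smoothTransition (s / ε)) s := fun s =>
    intervalIntegral.integral_hasDerivAt_right (hint _ _)
      (hst.stronglyMeasurableAtFilter _ _) hst.continuousAt
  have hderiv : deriv p = fun s => Real.smoothTransition (s / ε) := funext fun s => (hd s).deriv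
  have hdiff : Differentiable ℝ p := fun s => (hd s).differentiableAt
  have h0 : ∀ s ≤ 0, p s = 0 := by
    intro s hs
    simp only [hp]
    rw [intervalIntegral.integral_symm, intervalIntegral.integral_congr (g := fun _ => 0)]
    · simp
    · intro r hr
      rw [uIcc_of_le hs] at hr
      exact Real.smoothTransition.zero_of_nonpos (div_nonpos_of_nonpos_of_nonneg hr.2 hε.le)
  have hpd : ∀ s, 0 ≤ deriv p s := fun s => by
    rw [hderiv]; exact Real.smoothTransition.nonneg _
  have hp1 : ∀ s, deriv p s ≤ 1 := fun s => by
    rw [hderiv]; exact Real.smoothTransition.le_one _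
  have hmono : Monotone p := monotone_of_deriv_nonneg hdiff hpd
  have hnn : ∀ s, 0 ≤ p s := fun s => by
    rcases le_total s 0 with h | h
    · rw [h0 s h]
    · rw [← h0 0 le_rfl]; exact hmono h
  refine ⟨p, ?_, h0, hpd, hp1, ?_, hnn, ?_⟩
  · rw [contDiff_infty_iff_deriv]
    refine ⟨hdiff, ?_⟩
    rw [hderiv]
    exact Real.smoothTransition.contDiff.comp (by fun_prop)
  · intro s
    rcases le_total s ε with h | h
    · linarith [hnn s]
    · have : p s = p ε + ∫ r in ε..s, Real.smoothTransition (r / ε) := by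
        simp only [hp]
        rw [intervalIntegral.integral_add_adjacent_intervals (hint _ _) (hint _ _)]
      rw [this, intervalIntegral.integral_congr (g := fun _ => 1)]
      · simp; linarith [hnn ε]
      · intro r hr
        rw [uIcc_of_le h] at hr
        exact Real.smoothTransition.one_of_one_le (by rw [le_div_iff₀ hε]; linarith [hr.1])
  · intro s
    rcases le_total s 0 with h | h
    · rw [h0 s h]; exact le_max_right _ _
    · refine le_trans ?_ (le_max_left _ _)
      have := image_sub_le_mul_sub_of_deriv_le hdiff hp1 h
      rw [h0 0 le_rfl] at this
      linarith



lemma IsTestFun.comp {Ω : Set (Euc n)} {φ : Euc n → ℝ} (h : IsTestFun Ω φ) {p : ℝ → ℝ}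
    (hp : ContDiff ℝ (⊤ : ℕ∞) p) (hp0 : p 0 = 0) : IsTestFun Ω (fun x => p (φ x)) := by
  refine ⟨hp.comp h.1, h.2.1.comp_left hp0, ?_⟩
  exact (closure_mono (Function.support_comp_subset hp0 φ)).trans h.2.2

lemma IsTestFun.grad_comp {Ω : Set (Euc n)} {φ : Euc n → ℝ} (h : IsTestFun Ω φ) {p : ℝ → ℝ}
    (hp : ContDiff ℝ (⊤ : ℕ∞) p) (x : Euc n) :
    gradient (fun x => p (φ x)) x = deriv p (φ x) • gradient φ x := by
  have h1 : HasDerivAt p (deriv p (φ x)) (φ x) :=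
    (hp.differentiable (by simp) (φ x)).hasDerivAt
  have h2 : HasFDerivAt φ (fderiv ℝ φ x) x := (h.1.differentiable (by simp) x).hasFDerivAt
  have := (h1.comp_hasFDerivAt x h2).fderiv
  simp only [gradient]
  change (InnerProductSpace.toDual ℝ _).symm (fderiv ℝ (p ∘ φ) x) = _
  rw [this, map_smul]

lemma IsTestFun.differentiable {Ω : Set (Euc n)} {φ : Euc n → ℝ} (h : IsTestFun Ω φ) :
    Differentiable ℝ φ := h.1.differentiable (by simp)

lemma IsTestFun.norm_grad {φ : Euc n → ℝ}  (x : Euc n) :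
    ‖gradient φ x‖ = ‖fderiv ℝ φ x‖ := by
  simp [gradient]

lemma IsTestFun.cont_grad {Ω : Set (Euc n)} {φ : Euc n → ℝ} (h : IsTestFun Ω φ) :
    Continuous (gradient φ) := by
  have := h.1.continuous_fderiv (by simp)
  unfold gradient
  fun_prop

lemma IsTestFun.supp_grad {Ω : Set (Euc n)} {φ : Euc n → ℝ} (h : IsTestFun Ω φ) :
    HasCompactSupport (gradient φ) := by
  have := h.2.1.fderiv ℝ
  exact this.comp_left (g := (InnerProductSpace.toDual ℝ (Euc n)).symm) (by simp)

lemma IsTestFun.memLp {Ω : Set (Euc n)} {φ : Euc n → ℝ} (h : IsTestFun Ω φ) (p : ℝ≥0∞) :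
    MemLp φ p volume := h.1.continuous.memLp_of_hasCompactSupport h.2.1

lemma IsTestFun.memLp_grad {Ω : Set (Euc n)} {φ : Euc n → ℝ} (h : IsTestFun Ω φ) (p : ℝ≥0∞) :
    MemLp (gradient φ) p volume := h.cont_grad.memLp_of_hasCompactSupport h.supp_grad

lemma IsTestFun.zero_off {Ω : Set (Euc n)} {φ : Euc n → ℝ} (h : IsTestFun Ω φ) {x} (hx : x ∉ Ω) :
    φ x = 0 := by
  by_contra hne
  exact hx (h.2.2 (subset_tsupport _ hne))

lemma IsTestFun.mono {Ω Ω' : Set (Euc n)} {φ : Euc n → ℝ} (h : IsTestFun Ω φ) (hs : Ω ⊆ Ω') :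
    IsTestFun Ω' φ := ⟨h.1, h.2.1, h.2.2.trans hs⟩

lemma IsTestFun.add {Ω : Set (Euc n)} {φ ψ : Euc n → ℝ} (h : IsTestFun Ω φ) (h' : IsTestFun Ω ψ) :
    IsTestFun Ω (fun x => φ x + ψ x) := by
  refine ⟨h.1.add h'.1, h.2.1.add h'.2.1, ?_⟩
  exact (tsupport_add φ ψ).trans (union_subset h.2.2 h'.2.2)

lemma IsTestFun.smul {Ω : Set (Euc n)} {φ : Euc n → ℝ} (h : IsTestFun Ω φ) (c : ℝ) :
    IsTestFun Ω (fun x => c * φ x) := by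
  have := h.comp (p := fun s => c * s) (by fun_prop) (by simp)
  exact this

lemma IsTestFun.grad_add {Ω Ω' : Set (Euc n)} {φ ψ : Euc n → ℝ} (h : IsTestFun Ω φ) (h' : IsTestFun Ω' ψ)
    (x : Euc n) : gradient (fun x => φ x + ψ x) x = gradient φ x + gradient ψ x := by
  simp only [gradient]
  rw [← map_add]
  congr 1
  exact fderiv_add (h.differentiable x) (h'.differentiable x)

lemma IsTestFun.grad_smul {Ω : Set (Euc n)} {φ : Euc n → ℝ} (h : IsTestFun Ω φ) (c : ℝ)
    (x : Euc n) : gradient (fun x => c * φ x) x = c • gradient φ x := by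
  have := h.grad_comp (p := fun s => c * s) (by fun_prop) x
  rw [this]
  congr 1
  simp

/-- L1 Sobolev/Poincare with support measure -/
lemma sobolev_one (hn : 2 ≤ n) : ∃ C : ℝ, 0 < C ∧ ∀ (φ : Euc n → ℝ) (S Ω : Set (Euc n)) (m : ℝ),
    IsTestFun Ω φ → MeasurableSet S → (∀ x ∉ S, φ x = 0) → volume S ≤ ENNReal.ofReal m → 0 ≤ m →
    ∫ x, |φ x| ≤ C * m ^ (1 / (n:ℝ)) * ∫ x, ‖gradient φ x‖ := by
  have hn1 : (1:ℝ≥0) < n := by exact_mod_cast (by omega : 1 < n)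
  set p : ℝ≥0 := NNReal.conjExponent (n : ℝ≥0) with hp
  have hc : NNReal.HolderConjugate (n : ℝ≥0) p := NNReal.HolderConjugate.conjExponent hn1
  set C0 := eLpNormLESNormFDerivOneConst (volume : Measure (Euc n)) p with hC0
  refine ⟨C0 + 1, by positivity, ?_⟩
  intro φ S Ω m hφ hS hS0 hSm hm
  have key := eLpNorm_le_eLpNorm_fderiv_one (volume : Measure (Euc n)) (u := φ) (p := p)
    (hφ.1.of_le (by simp)) hφ.2.1 (by simpa using hc)
  have hr : eLpNorm φ 1 volume ≤ eLpNorm φ p volume * ENNReal.ofReal m ^ (1 / (n:ℝ)) := by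
    have hrestr : ∀ q, eLpNorm φ q volume = eLpNorm φ q (volume.restrict S) := by
      intro q
      rw [← eLpNorm_indicator_eq_eLpNorm_restrict hS]
      congr 1
      symm
      rw [indicator_eq_self]
      intro x hx
      by_contra h
      exact hx (hS0 x h)
    rw [hrestr, hrestr]
    have h1p : (1:ℝ≥0∞) ≤ p := by
      have := hc.symm.lt
      exact_mod_cast this.le
    refine (eLpNorm_le_eLpNorm_mul_rpow_measure_univ h1p
      (hφ.1.continuous.aestronglyMeasurable)).trans ?_
    gcongr
    rw [Measure.restrict_apply_univ]
    have : 1 / ENNReal.toReal 1 - 1 / (p:ℝ≥0∞).toReal = 1 / (n:ℝ) := by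
      have := hc.coe.inv_add_inv_eq_one
      simp at this ⊢
      linarith
    rw [this]
    gcongr
  have hfin : eLpNorm (fderiv ℝ φ) 1 volume ≠ ⊤ := by
    have := (hφ.memLp_grad 1).2.ne
    rwa [eLpNorm_congr_norm_ae (g := fderiv ℝ φ)] at this
    exact Eventually.of_forall fun x => IsTestFun.norm_grad x
  have h3 : eLpNorm φ 1 volume ≤ C0 * eLpNorm (fderiv ℝ φ) 1 volume * ENNReal.ofReal m ^ (1 / (n:ℝ)) :=
    hr.trans (by gcongr)
  have h4 := ENNReal.toReal_mono (by
    refine ENNReal.mul_ne_top (ENNReal.mul_ne_top (by simp) hfin) ?_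
    exact ENNReal.rpow_ne_top_of_nonneg (by positivity) (by simp)) h3
  rw [ENNReal.toReal_mul, ENNReal.toReal_mul, ← ENNReal.toReal_rpow, ENNReal.toReal_ofReal hm,
    eLpNorm_one_eq_lintegral_enorm, eLpNorm_one_eq_lintegral_enorm,
    ← integral_norm_eq_lintegral_enorm hφ.1.continuous.aestronglyMeasurable,
    ← integral_norm_eq_lintegral_enorm
      (hφ.1.continuous_fderiv (by simp)).aestronglyMeasurable] at h4
  simp only [Real.norm_eq_abs, ENNReal.coe_toReal] at h4
  simp only [IsTestFun.norm_grad]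
  refine h4.trans ?_
  have : 0 ≤ ∫ x, ‖fderiv ℝ φ x‖ := integral_nonneg fun _ => norm_nonneg _
  have h5 : 0 ≤ m ^ (1 / (n:ℝ)) := by positivity
  nlinarith [mul_nonneg this h5]



abbrev LL (n : ℕ) := Lp ℝ 2 (volume : Measure (Euc n))
abbrev VV (n : ℕ) := Lp (Euc n) 2 (volume : Measure (Euc n))
abbrev XX (n : ℕ) := WithLp 2 (LL n × VV n)

def mkX (u : Euc n → ℝ) (Du : Euc n → Euc n) (hu : MemLp u 2 volume) (hD : MemLp Du 2 volume) :
    XX n := WithLp.toLp 2 (hu.toLp u, hD.toLp Du)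

def tx {Ω : Set (Euc n)} (φ : Euc n → ℝ) (h : IsTestFun Ω φ) : XX n :=
  mkX φ (gradient φ) (h.memLp 2) (h.memLp_grad 2)

lemma norm_toLp_sq {F : Type*} [NormedAddCommGroup F] [InnerProductSpace ℝ F] {f : Euc n → F}
    (hf : MemLp f 2 volume) : ‖hf.toLp f‖ ^ 2 = ∫ x, ‖f x‖ ^ 2 := by
  rw [← real_inner_self_eq_norm_sq, L2.inner_def]
  refine integral_congr_ae ?_
  filter_upwards [hf.coeFn_toLp] with x hx
  rw [hx, real_inner_self_eq_norm_sq]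

lemma norm_Lp_sq {F : Type*} [NormedAddCommGroup F] [InnerProductSpace ℝ F]
    (f : Lp F 2 (volume : Measure (Euc n))) : ‖f‖ ^ 2 = ∫ x, ‖f x‖ ^ 2 := by
  rw [← real_inner_self_eq_norm_sq, L2.inner_def]
  simp only [real_inner_self_eq_norm_sq]

lemma inner_toLp {F : Type*} [NormedAddCommGroup F] [InnerProductSpace ℝ F] {f g : Euc n → F}
    (hf : MemLp f 2 volume) (hg : MemLp g 2 volume) :
    inner ℝ (hf.toLp f) (hg.toLp g) = ∫ x, inner ℝ (f x) (g x) := by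
  rw [L2.inner_def]
  refine integral_congr_ae ?_
  filter_upwards [hf.coeFn_toLp, hg.coeFn_toLp] with x hx hy
  rw [hx, hy]

lemma normX_sq (x : XX n) : ‖x‖ ^ 2 = ‖x.fst‖ ^ 2 + ‖x.snd‖ ^ 2 :=
  WithLp.prod_norm_sq_eq_of_L2 x

lemma normX_fst_le (x : XX n) : ‖x.fst‖ ≤ ‖x‖ := by
  have := normX_sq x
  refine le_of_pow_le_pow_left₀ two_ne_zero (norm_nonneg _) ?_
  nlinarith [sq_nonneg ‖x.snd‖]

lemma normX_snd_le (x : XX n) : ‖x.snd‖ ≤ ‖x‖ := by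
  have := normX_sq x
  refine le_of_pow_le_pow_left₀ two_ne_zero (norm_nonneg _) ?_
  nlinarith [sq_nonneg ‖x.fst‖]

lemma cont_fst : Continuous (fun x : XX n => x.fst) := (WithLp.fstL 2 ℝ (LL n) (VV n)).continuous
lemma cont_snd : Continuous (fun x : XX n => x.snd) := (WithLp.sndL 2 ℝ (LL n) (VV n)).continuous

lemma tx_fst {Ω : Set (Euc n)} {φ : Euc n → ℝ} (h : IsTestFun Ω φ) :
    (tx φ h).fst = (h.memLp 2).toLp φ := rfl
lemma tx_snd {Ω : Set (Euc n)} {φ : Euc n → ℝ} (h : IsTestFun Ω φ) :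
    (tx φ h).snd = (h.memLp_grad 2).toLp (gradient φ) := rfl

lemma tx_add {Ω Ω' Ω'': Set (Euc n)} {φ ψ : Euc n → ℝ} (h : IsTestFun Ω φ) (h' : IsTestFun Ω' ψ)
    (h'' : IsTestFun Ω'' (fun x => φ x + ψ x)) :
    tx _ h'' = tx φ h + tx ψ h' := by
  have h1 : (tx _ h'').fst = (tx φ h + tx ψ h').fst := by
    rw [WithLp.add_fst, tx_fst, tx_fst, tx_fst, ← MemLp.toLp_add]
    rfl
  have h2 : (tx _ h'').snd = (tx φ h + tx ψ h').snd := by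
    rw [WithLp.add_snd, tx_snd, tx_snd, tx_snd, ← MemLp.toLp_add]
    congr 1
    funext x
    exact h.grad_add h' x
  exact WithLp.ofLp_injective 2 (Prod.ext h1 h2)

lemma tx_smul {Ω Ω' : Set (Euc n)} {φ : Euc n → ℝ} (h : IsTestFun Ω φ) (c : ℝ)
    (h' : IsTestFun Ω' (fun x => c * φ x)) :
    tx _ h' = c • tx φ h := by
  have h1 : (tx _ h').fst = (c • tx φ h).fst := by
    rw [WithLp.smul_fst, tx_fst, tx_fst, ← MemLp.toLp_const_smul]
    rfl
  have h2 : (tx _ h').snd = (c • tx φ h).snd := by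
    rw [WithLp.smul_snd, tx_snd, tx_snd, ← MemLp.toLp_const_smul]
    congr 1
    funext x
    exact h.grad_smul c x
  exact WithLp.ofLp_injective 2 (Prod.ext h1 h2)

lemma isTestFun_zero (Ω : Set (Euc n)) : IsTestFun Ω (fun _ => (0:ℝ)) := by
  refine ⟨contDiff_const, ?_, ?_⟩
  · exact HasCompactSupport.zero
  · have : tsupport (fun _ : Euc n => (0:ℝ)) = ∅ := by
      rw [tsupport_eq_empty_iff]; rfl
    rw [this]; exact empty_subset _

def TT (Ω : Set (Euc n)) : Submodule ℝ (XX n) where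
  carrier := {x | ∃ (φ : Euc n → ℝ) (h : IsTestFun Ω φ), x = tx φ h}
  add_mem' := by
    rintro _ _ ⟨φ, h, rfl⟩ ⟨ψ, h', rfl⟩
    exact ⟨_, h.add h', (tx_add h h' _).symm⟩
  zero_mem' := by
    refine ⟨_, isTestFun_zero Ω, ?_⟩
    have h := tx_smul (isTestFun_zero Ω) 0 ((isTestFun_zero Ω).smul 0)
    rw [zero_smul] at h
    rw [← h]
    congr 1
    funext x; simp
  smul_mem' := by
    rintro c _ ⟨φ, h, rfl⟩
    exact ⟨_, h.smul c, (tx_smul h c _).symm⟩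

def HH (Ω : Set (Euc n)) : Submodule ℝ (XX n) := (TT Ω).topologicalClosure

lemma isClosed_HH (Ω : Set (Euc n)) : IsClosed (HH Ω : Set (XX n)) :=
  (TT Ω).isClosed_topologicalClosure

instance (Ω : Set (Euc n)) : CompleteSpace (HH Ω) := (isClosed_HH Ω).completeSpace_coe

lemma tx_mem {Ω : Set (Euc n)} {φ : Euc n → ℝ} (h : IsTestFun Ω φ) : tx φ h ∈ HH Ω :=
  (TT Ω).le_topologicalClosure ⟨φ, h, rfl⟩

lemma HH_mono {Ω Ω' : Set (Euc n)} (h : Ω ⊆ Ω') : HH Ω ≤ HH Ω' := by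
  refine Submodule.topologicalClosure_mono ?_
  rintro _ ⟨φ, hφ, rfl⟩
  exact ⟨φ, hφ.mono h, rfl⟩

lemma HH_approx {Ω : Set (Euc n)} {x : XX n} (hx : x ∈ HH Ω) :
    ∃ φ : ℕ → Euc n → ℝ, ∃ h : ∀ k, IsTestFun Ω (φ k),
      Tendsto (fun k => tx (φ k) (h k)) atTop (𝓝 x) := by
  have : x ∈ closure (TT Ω : Set (XX n)) := hx
  rw [mem_closure_iff_seq_limit] at this
  obtain ⟨y, hy, hlim⟩ := this
  choose φ h hφ using hy
  refine ⟨φ, h, ?_⟩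
  have : y = fun k => tx (φ k) (h k) := funext hφ
  rwa [this] at hlim

lemma sub_mkX_norm_sq {Ω : Set (Euc n)} {φ : Euc n → ℝ} (h : IsTestFun Ω φ)
    {u : Euc n → ℝ} {Du : Euc n → Euc n} (hu : MemLp u 2 volume) (hD : MemLp Du 2 volume) :
    ‖tx φ h - mkX u Du hu hD‖ ^ 2 =
      (∫ x, (φ x - u x) ^ 2) + ∫ x, ‖gradient φ x - Du x‖ ^ 2 := by
  rw [normX_sq, WithLp.sub_fst, WithLp.sub_snd, tx_fst, tx_snd]
  change ‖_ - hu.toLp u‖ ^ 2 + ‖_ - hD.toLp Du‖ ^ 2 = _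
  rw [← MemLp.toLp_sub, ← MemLp.toLp_sub, norm_toLp_sq, norm_toLp_sq]
  simp

lemma mkX_mem {Ω : Set (Euc n)} {u : Euc n → ℝ} {Du : Euc n → Euc n} (h : MemH10 Ω u Du) :
    mkX u Du h.1 h.2.1 ∈ HH Ω := by
  obtain ⟨hu, hD, φ, hφ, h1, h2⟩ := h
  have : mkX u Du hu hD ∈ closure (TT Ω : Set (XX n)) := by
    rw [mem_closure_iff_seq_limit]
    refine ⟨fun k => tx (φ k) (hφ k), fun k => ⟨_, _, rfl⟩, ?_⟩
    rw [tendsto_iff_norm_sub_tendsto_zero]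
    have h3 := h1.add h2
    rw [add_zero] at h3
    have h4 := h3.sqrt
    rw [Real.sqrt_zero] at h4
    refine h4.congr fun k => ?_
    rw [← sub_mkX_norm_sq (hφ k) hu hD, Real.sqrt_sq (norm_nonneg _)]
  exact this

lemma mkX_self (x : XX n) : mkX x.fst x.snd (Lp.memLp _) (Lp.memLp _) = x := by
  apply WithLp.ofLp_injective 2
  apply Prod.ext
  · exact Lp.toLp_coeFn _ (Lp.memLp _)
  · exact Lp.toLp_coeFn _ (Lp.memLp _)

lemma HH_memH10 {Ω : Set (Euc n)} {x : XX n} (hx : x ∈ HH Ω) : MemH10 Ω x.fst x.snd := by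
  obtain ⟨φ, h, hlim⟩ := HH_approx hx
  refine ⟨Lp.memLp _, Lp.memLp _, φ, h, ?_⟩
  rw [tendsto_iff_norm_sub_tendsto_zero] at hlim
  have h2 := hlim.pow 2
  simp only [ne_eq, OfNat.ofNat_ne_zero, not_false_eq_true, zero_pow] at h2
  have h3 : ∀ k, ‖tx (φ k) (h k) - x‖ ^ 2 = (∫ y, (φ k y - x.fst y) ^ 2) +
      ∫ y, ‖gradient (φ k) y - x.snd y‖ ^ 2 := by
    intro k
    conv_lhs => rw [← mkX_self x]
    rw [sub_mkX_norm_sq]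
  simp only [h3] at h2
  constructor
  · refine squeeze_zero (fun k => integral_nonneg fun _ => by positivity) (fun k => ?_) h2
    have : 0 ≤ ∫ y, ‖gradient (φ k) y - x.snd y‖ ^ 2 := integral_nonneg fun _ => by positivity
    linarith
  · refine squeeze_zero (fun k => integral_nonneg fun _ => by positivity) (fun k => ?_) h2
    have : 0 ≤ ∫ y, (φ k y - x.fst y) ^ 2 := integral_nonneg fun _ => by positivity
    linarith

/-- multiplication by indicator, as inner product with `1_Ω` etc: elements vanish off Ω -/
lemma HH_zero_off {Ω : Set (Euc n)} (hΩ : MeasurableSet Ω) {x : XX n} (hx : x ∈ HH Ω) :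
    ∀ᵐ y, y ∉ Ω → x.fst y = 0 := by
  obtain ⟨hu, hD, φ, h, h1, h2⟩ := HH_memH10 hx
  have hle : ∀ k, ∫ y in Ωᶜ, (x.fst y) ^ 2 ≤ ∫ y, (φ k y - x.fst y) ^ 2 := by
    intro k
    have hi : Integrable (fun y => (φ k y - x.fst y) ^ 2) :=
      (((h k).memLp 2).sub hu).integrable_sq
    calc ∫ y in Ωᶜ, (x.fst y) ^ 2 = ∫ y in Ωᶜ, (φ k y - x.fst y) ^ 2 := by
          refine setIntegral_congr_fun hΩ.compl fun y hy => ?_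
          simp only [(h k).zero_off hy]; ring
      _ ≤ _ := setIntegral_le_integral hi (Eventually.of_forall fun _ => by positivity)
  have h0 : ∫ y in Ωᶜ, (x.fst y) ^ 2 = 0 :=
    le_antisymm (ge_of_tendsto' h1 hle) (integral_nonneg fun _ => by positivity)
  rw [setIntegral_eq_zero_iff_of_nonneg_ae (Eventually.of_forall fun _ => by positivity)
    hu.integrable_sq.integrableOn] at h0
  rw [EventuallyEq, ae_restrict_iff' hΩ.compl] at h0
  filter_upwards [h0] with y hy hn
  simpa using hy hn

/-! Poincare -/

lemma cs_mul {f g : Euc n → ℝ} (hf : MemLp f 2 volume) (hg : MemLp g 2 volume) :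
    (∫ x, f x * g x) ^ 2 ≤ (∫ x, f x ^ 2) * ∫ x, g x ^ 2 := by
  have h1 := inner_toLp hf hg
  have h2 := abs_real_inner_le_norm (hf.toLp f) (hg.toLp g)
  have h3 := norm_toLp_sq hf
  have h4 := norm_toLp_sq hg
  simp only [Real.norm_eq_abs, sq_abs] at h3 h4
  have h5 : ∫ x, f x * g x = inner ℝ (hf.toLp f) (hg.toLp g) := by
    rw [h1]; congr 1; funext x; simp [mul_comm]
  rw [← h3, ← h4, h5, ← mul_pow, ← sq_abs]
  gcongr

lemma poincare_test (hn : 2 ≤ n) : ∃ C : ℝ, 0 < C ∧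
    ∀ (φ : Euc n → ℝ) (S Ω : Set (Euc n)) (m : ℝ),
    IsTestFun Ω φ → MeasurableSet S → (∀ x ∉ S, φ x = 0) → (∀ x ∉ S, gradient φ x = 0) →
    volume S ≤ ENNReal.ofReal m → 0 ≤ m →
    (∫ x, |φ x|) ^ 2 ≤ C * m ^ (1 + 2 / (n:ℝ)) * ∫ x, ‖gradient φ x‖ ^ 2 ∧
    (∫ x, φ x ^ 2) ≤ C * m ^ (2 / (n:ℝ)) * ∫ x, ‖gradient φ x‖ ^ 2 := by
  obtain ⟨C, hC, hs⟩ := sobolev_one hn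
  refine ⟨4 * C ^ 2, by positivity, ?_⟩
  intro φ S Ω m hφ hS h0 hg0 hSm hm
  have hn0 : (0:ℝ) < n := by exact_mod_cast (by omega : 0 < n)
  have hE : 0 ≤ ∫ x, ‖gradient φ x‖ ^ 2 := integral_nonneg fun _ => by positivity
  have hr2 : (m ^ (1 / (n:ℝ))) ^ 2 = m ^ (2 / (n:ℝ)) := by
    rw [← Real.rpow_natCast, ← Real.rpow_mul hm]; congr 1; push_cast; ring
  have hr1 : m ^ (1 + 2 / (n:ℝ)) = m * m ^ (2 / (n:ℝ)) := by
    rw [Real.rpow_add' hm (by positivity), Real.rpow_one]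
  have hfin : volume S ≠ ⊤ := (hSm.trans_lt ENNReal.ofReal_lt_top).ne
  constructor
  · have h1 := hs φ S Ω m hφ hS h0 hSm hm
    have hind : MemLp (S.indicator fun _ => (1:ℝ)) 2 volume := memLp_indicator_const 2 hS 1 (Or.inr hfin)
    have h2 := cs_mul hind (hφ.memLp_grad 2).norm
    have e1 : ∀ x, S.indicator (fun _ => (1:ℝ)) x * ‖gradient φ x‖ = ‖gradient φ x‖ := by
      intro x
      by_cases hx : x ∈ S
      · simp [hx]
      · simp [hx, hg0 x hx]
    have e2 : (∫ x, S.indicator (fun _ => (1:ℝ)) x ^ 2) ≤ m := by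
      have : (fun x => S.indicator (fun _ => (1:ℝ)) x ^ 2) = S.indicator (fun _ => (1:ℝ)) := by
        funext x
        by_cases hx : x ∈ S <;> simp [hx]
      rw [this, integral_indicator hS]
      simp only [integral_const, smul_eq_mul, mul_one]
      rw [measureReal_restrict_apply_univ]
      exact ENNReal.toReal_le_of_le_ofReal hm hSm
    simp only [e1] at h2
    have h3 : (∫ x, ‖gradient φ x‖) ^ 2 ≤ m * ∫ x, ‖gradient φ x‖ ^ 2 := h2.trans (by gcongr)
    have h4 : (∫ x, |φ x|) ^ 2 ≤ (C * m ^ (1 / (n:ℝ)) * ∫ x, ‖gradient φ x‖) ^ 2 := by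
      have : 0 ≤ ∫ x, |φ x| := integral_nonneg fun _ => abs_nonneg _
      gcongr
    rw [mul_pow, mul_pow, hr2] at h4
    rw [hr1]
    have hk : 0 ≤ C ^ 2 * m ^ (2 / (n:ℝ)) := by positivity
    have h5 := mul_le_mul_of_nonneg_left h3 hk
    have h6 : 0 ≤ C ^ 2 * m ^ (2 / (n:ℝ)) * (m * ∫ x, ‖gradient φ x‖ ^ 2) := by positivity
    nlinarith
  · have hsq : IsTestFun Ω (fun x => φ x ^ 2) := hφ.comp (p := fun s => s ^ 2) (by fun_prop) (by simp)
    have h1 := hs _ S Ω m hsq hS (fun x hx => by simp [h0 x hx]) hSm hm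
    have hg : ∀ x, ‖gradient (fun x => φ x ^ 2) x‖ = 2 * (|φ x| * ‖gradient φ x‖) := by
      intro x
      rw [hφ.grad_comp (p := fun s => s ^ 2) (by fun_prop), norm_smul]
      simp; ring
    simp only [hg, abs_pow, sq_abs, integral_const_mul] at h1
    have h2 := cs_mul (hφ.memLp 2).norm (hφ.memLp_grad 2).norm
    simp only [Real.norm_eq_abs, sq_abs] at h2
    set A := ∫ x, φ x ^ 2
    set B := ∫ x, |φ x| * ‖gradient φ x‖
    have hA : 0 ≤ A := integral_nonneg fun _ => by positivity
    have h4 : A ^ 2 ≤ (C * m ^ (1 / (n:ℝ)) * (2 * B)) ^ 2 := by gcongr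
    rw [mul_pow, mul_pow, hr2, mul_pow] at h4
    have hk : 0 ≤ C ^ 2 * m ^ (2 / (n:ℝ)) := by positivity
    have h5 := mul_le_mul_of_nonneg_left h2 hk
    rcases hA.eq_or_lt with h | h
    · rw [← h]; positivity
    · have : A * A ≤ A * (4 * C ^ 2 * m ^ (2 / (n:ℝ)) * ∫ x, ‖gradient φ x‖ ^ 2) := by nlinarith
      exact le_of_mul_le_mul_left this h

lemma IsTestFun.grad_zero_off {Ω : Set (Euc n)} {φ : Euc n → ℝ} (h : IsTestFun Ω φ) {x} (hx : x ∉ Ω) :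
    gradient φ x = 0 := by
  have : fderiv ℝ φ x = 0 := by
    by_contra hne
    exact hx (h.2.2 (support_fderiv_subset ℝ hne))
  simp [gradient, this]

lemma poincare_HH (hn : 2 ≤ n) (vmax : ℝ) (hv : 0 < vmax) : ∃ C : ℝ, 0 < C ∧
    ∀ Ω : Set (Euc n), IsOpen Ω → volume Ω ≤ ENNReal.ofReal vmax → ∀ x ∈ HH Ω,
      ‖x.fst‖ ^ 2 ≤ C * ‖x.snd‖ ^ 2 := by
  obtain ⟨C, hC, hs⟩ := poincare_test hn
  refine ⟨C * vmax ^ (2 / (n:ℝ)), by positivity, ?_⟩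
  intro Ω hΩ hvol x hx
  obtain ⟨φ, h, hlim⟩ := HH_approx hx
  have l1 := ((cont_fst.tendsto x).comp hlim).norm.pow 2
  have l2 := (((cont_snd.tendsto x).comp hlim).norm.pow 2).const_mul (C * vmax ^ (2 / (n:ℝ)))
  refine le_of_tendsto_of_tendsto' l1 l2 fun k => ?_
  have := (hs (φ k) Ω Ω vmax (h k) hΩ.measurableSet (fun x hx => (h k).zero_off hx)
    (fun x hx => (h k).grad_zero_off hx) hvol hv.le).2
  simp only [Function.comp, tx_fst, tx_snd, norm_toLp_sq]
  simpa using this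



lemma laxM {K E F : Type*} [NormedAddCommGroup K] [InnerProductSpace ℝ K] [CompleteSpace K]
    [NormedAddCommGroup E] [InnerProductSpace ℝ E] [CompleteSpace E]
    [NormedAddCommGroup F] [InnerProductSpace ℝ F]
    (a : K →L[ℝ] E) (d : K →L[ℝ] F) (σ c : ℝ) (hc : 0 < c)
    (hco : ∀ x, c * ‖x‖ ^ 2 ≤ ‖d x‖ ^ 2 - σ * ‖a x‖ ^ 2) (g : E) :
    ∃ x, ∀ y, inner ℝ (d x) (d y) - σ * inner ℝ (a x) (a y) = inner ℝ g (a y) := by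
  let B0 : K →ₗ[ℝ] K →ₗ[ℝ] ℝ := LinearMap.mk₂ ℝ
    (fun x y => inner ℝ (d x) (d y) - σ * inner ℝ (a x) (a y))
    (fun x x' y => by simp only [map_add, inner_add_left]; ring)
    (fun r x y => by simp only [map_smul, real_inner_smul_left, smul_eq_mul]; ring)
    (fun x y y' => by simp only [map_add, inner_add_right]; ring)
    (fun r x y => by simp only [map_smul, real_inner_smul_right, smul_eq_mul]; ring)
  let B : K →L[ℝ] K →L[ℝ] ℝ := B0.mkContinuous₂ (‖d‖ ^ 2 + |σ| * ‖a‖ ^ 2) (by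
    intro x y
    change ‖inner ℝ (d x) (d y) - σ * inner ℝ (a x) (a y)‖ ≤ _
    refine (norm_sub_le _ _).trans ?_
    rw [norm_mul, Real.norm_eq_abs σ]
    have h1 : ‖inner ℝ (d x) (d y)‖ ≤ (‖d‖ * ‖x‖) * (‖d‖ * ‖y‖) :=
      (norm_inner_le_norm _ _).trans (by gcongr <;> exact ContinuousLinearMap.le_opNorm _ _)
    have h2 : ‖inner ℝ (a x) (a y)‖ ≤ (‖a‖ * ‖x‖) * (‖a‖ * ‖y‖) :=
      (norm_inner_le_norm _ _).trans (by gcongr <;> exact ContinuousLinearMap.le_opNorm _ _)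
    have h3 := mul_le_mul_of_nonneg_left h2 (abs_nonneg σ)
    nlinarith)
  have hB : ∀ x y, B x y = inner ℝ (d x) (d y) - σ * inner ℝ (a x) (a y) := fun x y => rfl
  have hcoer : IsCoercive B := ⟨c, hc, fun x => by
    rw [hB, real_inner_self_eq_norm_sq, real_inner_self_eq_norm_sq]
    have := hco x
    nlinarith⟩
  refine ⟨hcoer.continuousLinearEquivOfBilin.symm (ContinuousLinearMap.adjoint a g), fun y => ?_⟩
  rw [← hB, ← hcoer.continuousLinearEquivOfBilin_apply, ContinuousLinearEquiv.apply_symm_apply,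
    ContinuousLinearMap.adjoint_inner_left]

def aX : XX n →L[ℝ] LL n := WithLp.fstL 2 ℝ (LL n) (VV n)
def dX : XX n →L[ℝ] VV n := WithLp.sndL 2 ℝ (LL n) (VV n)

lemma solve_sub (K : Submodule ℝ (XX n)) (hK : IsClosed (K : Set (XX n))) (σ c : ℝ) (hc : 0 < c)
    (hco : ∀ x ∈ K, c * ‖x‖ ^ 2 ≤ ‖x.snd‖ ^ 2 - σ * ‖x.fst‖ ^ 2) (g : LL n) :
    ∃ x ∈ K, ∀ y ∈ K, inner ℝ x.snd y.snd - σ * inner ℝ x.fst y.fst = inner ℝ g y.fst := by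
  have : CompleteSpace K := hK.completeSpace_coe
  obtain ⟨x, hx⟩ := laxM (aX.comp K.subtypeL) (dX.comp K.subtypeL) σ c hc
    (fun x => hco x x.2) g
  exact ⟨x, x.2, fun y hy => hx ⟨y, hy⟩⟩

def Sol (Ω : Set (Euc n)) (G : LL n) (w : XX n) : Prop :=
  w ∈ HH Ω ∧ ∀ y ∈ HH Ω, inner ℝ w.snd y.snd = inner ℝ G y.fst

lemma exists_sol (Ω : Set (Euc n)) (C : ℝ) (hC : 0 < C)
    (hP : ∀ x ∈ HH Ω, ‖x.fst‖ ^ 2 ≤ C * ‖x.snd‖ ^ 2) (G : LL n) : ∃ w, Sol Ω G w := by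
  obtain ⟨w, hw, h⟩ := solve_sub (HH Ω) (isClosed_HH Ω) 0 (C + 1)⁻¹ (by positivity) (by
    intro x hx
    have := hP x hx
    rw [normX_sq, inv_mul_le_iff₀ (by positivity)]
    nlinarith) G
  exact ⟨w, hw, fun y hy => by simpa using h y hy⟩

def JJ (G : LL n) (y : XX n) : ℝ := 1 / 2 * ‖y.snd‖ ^ 2 - inner ℝ G y.fst

lemma cont_JJ (G : LL n) : Continuous (JJ G) := by
  have := cont_fst (n := n)
  have := cont_snd (n := n)
  unfold JJ
  fun_prop

lemma Sol.J_eq {Ω : Set (Euc n)} {G : LL n} {w y : XX n} (h : Sol Ω G w) (hy : y ∈ HH Ω) :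
    JJ G y = JJ G w + 1 / 2 * ‖y.snd - w.snd‖ ^ 2 := by
  have h1 := h.2 y hy
  have h2 := h.2 w h.1
  have h3 := norm_sub_sq_real y.snd w.snd
  rw [real_inner_self_eq_norm_sq] at h2
  rw [real_inner_comm] at h1
  unfold JJ
  linarith

lemma Sol.J_le {Ω : Set (Euc n)} {G : LL n} {w y : XX n} (h : Sol Ω G w) (hy : y ∈ HH Ω) :
    JJ G w ≤ JJ G y := by
  rw [h.J_eq hy]; nlinarith [sq_nonneg ‖y.snd - w.snd‖]

lemma real_inner_eq (f g : LL n) : inner ℝ f g = ∫ x, f x * g x := by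
  rw [L2.inner_def]; congr 1; funext x; simp [mul_comm]

lemma integrable_mulL (f g : LL n) : Integrable (fun x => f x * g x) := by
  have := L2.integrable_inner (𝕜 := ℝ) f g
  refine this.congr (Eventually.of_forall fun x => ?_)
  simp [mul_comm]

lemma inner_mono {G f g : LL n} (hG : ∀ᵐ x, 0 ≤ G x) (h : ∀ᵐ x, f x ≤ g x) :
    inner ℝ G f ≤ inner ℝ G g := by
  rw [real_inner_eq, real_inner_eq]
  refine integral_mono_ae (integrable_mulL _ _) (integrable_mulL _ _) ?_
  filter_upwards [hG, h] with x h1 h2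
  gcongr

def oneL (Ω : Set (Euc n)) (h : MeasurableSet Ω) (hf : volume Ω ≠ ⊤) : LL n :=
  indicatorConstLp 2 h hf 1

lemma oneL_ae (Ω : Set (Euc n)) (h : MeasurableSet Ω) (hf : volume Ω ≠ ⊤) :
    ∀ᵐ x, oneL Ω h hf x = Ω.indicator (fun _ => (1:ℝ)) x := indicatorConstLp_coeFn

lemma J_trunc {Ω Ω' : Set (Euc n)} (hm : MeasurableSet Ω') (hf : volume Ω' ≠ ⊤)
    {φ : Euc n → ℝ} (hφ : IsTestFun Ω' φ) {p : ℝ → ℝ} (hp : ContDiff ℝ (⊤ : ℕ∞) p)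
    (hp0 : ∀ s ≤ 0, p s = 0) (hd0 : ∀ s, 0 ≤ deriv p s) (hd1 : ∀ s, deriv p s ≤ 1)
    {ε : ℝ} (hε : ∀ s, s - ε ≤ p s) (hη : IsTestFun Ω (fun x => p (φ x)))
    {G : LL n} (hG : ∀ᵐ x, 0 ≤ G x) :
    JJ G (tx _ hη) ≤ JJ G (tx φ hφ) + ε * inner ℝ G (oneL Ω' hm hf) := by
  have h1 : ‖(tx _ hη).snd‖ ^ 2 ≤ ‖(tx φ hφ).snd‖ ^ 2 := by
    rw [tx_snd, tx_snd, norm_toLp_sq, norm_toLp_sq]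
    refine integral_mono (hη.memLp_grad 2).norm.integrable_sq (hφ.memLp_grad 2).norm.integrable_sq ?_
    intro x
    simp only
    rw [hφ.grad_comp hp, norm_smul, Real.norm_of_nonneg (hd0 _)]
    have := hd1 (φ x)
    have := hd0 (φ x)
    have h2 : deriv p (φ x) * ‖gradient φ x‖ ≤ ‖gradient φ x‖ :=
      mul_le_of_le_one_left (norm_nonneg _) (hd1 _)
    gcongr
  have h2 : inner ℝ G (tx φ hφ).fst ≤ inner ℝ G ((tx _ hη).fst + ε • oneL Ω' hm hf) := by
    refine inner_mono hG ?_
    filter_upwards [(hφ.memLp 2).coeFn_toLp, (hη.memLp 2).coeFn_toLp, oneL_ae Ω' hm hf,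
      Lp.coeFn_add (tx _ hη).fst (ε • oneL Ω' hm hf), Lp.coeFn_smul ε (oneL Ω' hm hf)]
      with x e1 e2 e3 e4 e5
    rw [e4, Pi.add_apply, e5, Pi.smul_apply, e3, tx_fst, tx_fst, e1, e2]
    by_cases hx : x ∈ Ω'
    · simp [hx]; linarith [hε (φ x)]
    · simp [hx, hφ.zero_off hx, hp0 0 le_rfl]
  rw [inner_add_right, real_inner_smul_right] at h2
  unfold JJ
  linarith

lemma test_nonneg {Ω Ω' : Set (Euc n)} (hs : Ω ⊆ Ω') (hm : MeasurableSet Ω') (hf : volume Ω' ≠ ⊤)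
    {G : LL n} (hG : ∀ᵐ x, 0 ≤ G x) {w : XX n} (hw : Sol Ω G w) {η : Euc n → ℝ}
    (hη : IsTestFun Ω' η) (hη0 : ∀ x, 0 ≤ η x) :
    inner ℝ w.snd (tx η hη).snd ≤ inner ℝ G (tx η hη).fst := by
  obtain ⟨ψ, hψ, hlim⟩ := HH_approx hw.1
  have hone : 0 ≤ inner ℝ G (oneL Ω' hm hf) := by
    rw [← inner_zero_right (𝕜 := ℝ) G]
    refine inner_mono hG ?_
    filter_upwards [oneL_ae Ω' hm hf, Lp.coeFn_zero ℝ 2 (volume : Measure (Euc n))] with x h1 h2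
    rw [h1, h2]
    exact indicator_nonneg (fun _ _ => zero_le_one) x
  set c := inner ℝ G (oneL Ω' hm hf) with hc
  have key : ∀ t : ℝ, 0 < t → JJ G w ≤ JJ G (w + (-t) • tx η hη) := by
    intro t ht
    refine le_of_forall_pos_le_add fun δ hδ => ?_
    set ε := δ / (c + 1) with hεd
    have hε : 0 < ε := by positivity
    have hεc : ε * c ≤ δ := by
      rw [hεd, div_mul_eq_mul_div, div_le_iff₀ (by positivity)]; nlinarith
    obtain ⟨p, hp, hp0, hd0, hd1, hpε, -, -⟩ := exists_p ε hε
    have hl : Tendsto (fun k => JJ G (tx (ψ k) (hψ k) + (-t) • tx η hη) + ε * c) atTop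
        (𝓝 (JJ G (w + (-t) • tx η hη) + ε * c)) :=
      (((cont_JJ G).tendsto _).comp (hlim.add_const _)).add_const _
    refine le_trans (ge_of_tendsto' hl fun k => ?_) (by linarith)
    have hφ : IsTestFun Ω' (fun x => ψ k x + (-t) * η x) := ((hψ k).mono hs).add (hη.smul (-t))
    have hsub : Function.support (fun x => p (ψ k x + (-t) * η x)) ⊆ Function.support (ψ k) := by
      intro x hx h0
      apply hx
      simp only
      rw [h0]
      apply hp0
      nlinarith [hη0 x]
    have hy : IsTestFun Ω (fun x => p (ψ k x + (-t) * η x)) :=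
      ⟨hp.comp hφ.1, (hψ k).2.1.mono hsub, (closure_mono hsub).trans (hψ k).2.2⟩
    have h1 := J_trunc hm hf hφ hp hp0 hd0 hd1 hpε hy hG
    have h2 := hw.J_le (tx_mem hy)
    rw [tx_add (hψ k) (hη.smul (-t)) hφ, tx_smul hη (-t)] at h1
    exact h2.trans h1
  set e := ‖(tx η hη).snd‖ ^ 2 with he
  have he0 : 0 ≤ e := by positivity
  by_contra hcon
  push Not at hcon
  set b := inner ℝ w.snd (tx η hη).snd - inner ℝ G (tx η hη).fst with hb
  have hb0 : 0 < b := by rw [hb]; linarith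
  have ht : 0 < b / (e + 1) := by positivity
  have h := key _ ht
  set t := b / (e + 1) with htd
  have hte : t * (e + 1) = b := by rw [htd]; field_simp
  unfold JJ at h
  rw [WithLp.add_fst, WithLp.add_snd, WithLp.smul_fst, WithLp.smul_snd, norm_add_sq_real,
    inner_add_right, real_inner_smul_right, real_inner_smul_right, norm_smul, mul_pow, ← he] at h
  simp only [norm_neg, Real.norm_eq_abs, sq_abs] at h
  have h5 : 0 ≤ t * (-b + t * e / 2) := by rw [hb]; linarith
  have h6 := nonneg_of_mul_nonneg_right h5 ht
  nlinarith

lemma D_nonneg {Ω Ω' : Set (Euc n)} (hs : Ω ⊆ Ω') (hm : MeasurableSet Ω') (hf : volume Ω' ≠ ⊤)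
    {C : ℝ} (hP : ∀ x ∈ HH Ω', ‖x.fst‖ ^ 2 ≤ C * ‖x.snd‖ ^ 2)
    {G ζ : LL n} (hG : ∀ᵐ x, 0 ≤ G x) (hζ : ∀ᵐ x, 0 ≤ ζ x) {w g : XX n} (hw : Sol Ω G w)
    (hg : Sol Ω' ζ g) :
    inner ℝ w.snd g.snd ≤ inner ℝ G g.fst := by
  obtain ⟨φ, hφ, hlim⟩ := HH_approx hg.1
  have hεpos : ∀ k : ℕ, (0:ℝ) < 1 / ((k:ℝ) + 1) := fun k => by positivity
  choose p hp hp0 hd0 hd1 hpε hpn _ using fun k : ℕ => exists_p _ (hεpos k)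
  have hη : ∀ k, IsTestFun Ω' (fun x => p k (φ k x)) := fun k =>
    (hφ k).comp (hp k) (hp0 k 0 le_rfl)
  set c := inner ℝ ζ (oneL Ω' hm hf) with hc
  have l1 : Tendsto (fun k => 2 * (JJ ζ (tx (φ k) (hφ k)) + 1 / ((k:ℝ) + 1) * c - JJ ζ g)) atTop
      (𝓝 (2 * (JJ ζ g + 0 * c - JJ ζ g))) :=
    (((((cont_JJ ζ).tendsto _).comp hlim).add
      (tendsto_one_div_add_atTop_nhds_zero_nat.mul_const c)).sub_const _).const_mul 2
  rw [zero_mul, add_zero, sub_self, mul_zero] at l1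
  have hsq : Tendsto (fun k => ‖(tx _ (hη k)).snd - g.snd‖ ^ 2) atTop (𝓝 0) := by
    refine squeeze_zero (fun k => by positivity) (fun k => ?_) l1
    have h1 := J_trunc hm hf (hφ k) (hp k) (hp0 k) (hd0 k) (hd1 k) (hpε k) (hη k) hζ
    have h2 := hg.J_eq (tx_mem (hη k))
    linarith
  have hsq1 : Tendsto (fun k => ‖(tx _ (hη k)).fst - g.fst‖ ^ 2) atTop (𝓝 0) := by
    have := hsq.const_mul C
    rw [mul_zero] at this
    refine squeeze_zero (fun k => by positivity) (fun k => ?_) this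
    have h := hP (tx _ (hη k) - g) (Submodule.sub_mem _ (tx_mem (hη k)) hg.1)
    rwa [WithLp.sub_fst, WithLp.sub_snd] at h
  have t2 : Tendsto (fun k => (tx _ (hη k)).snd) atTop (𝓝 g.snd) := by
    rw [tendsto_iff_norm_sub_tendsto_zero]
    have := hsq.sqrt
    rw [Real.sqrt_zero] at this
    exact this.congr fun k => Real.sqrt_sq (norm_nonneg _)
  have t1 : Tendsto (fun k => (tx _ (hη k)).fst) atTop (𝓝 g.fst) := by
    rw [tendsto_iff_norm_sub_tendsto_zero]
    have := hsq1.sqrt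
    rw [Real.sqrt_zero] at this
    exact this.congr fun k => Real.sqrt_sq (norm_nonneg _)
  refine le_of_tendsto_of_tendsto' (tendsto_const_nhds.inner t2) (tendsto_const_nhds.inner t1)
    fun k => test_nonneg hs hm hf hG hw (hη k) (fun x => hpn k _)



def PT (n : ℕ) (C : ℝ) : Prop :=
  ∀ (φ : Euc n → ℝ) (S Ω : Set (Euc n)) (m : ℝ),
    IsTestFun Ω φ → MeasurableSet S → (∀ x ∉ S, φ x = 0) → (∀ x ∉ S, gradient φ x = 0) →
    volume S ≤ ENNReal.ofReal m → 0 ≤ m →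
    (∫ x, |φ x|) ^ 2 ≤ C * m ^ (1 + 2 / (n:ℝ)) * ∫ x, ‖gradient φ x‖ ^ 2 ∧
    (∫ x, φ x ^ 2) ≤ C * m ^ (2 / (n:ℝ)) * ∫ x, ‖gradient φ x‖ ^ 2

def ff (φ : Euc n → ℝ) (l : ℝ) : ℝ := ∫ x, max (φ x - l) 0

lemma ff_nonneg (φ : Euc n → ℝ) (l : ℝ) : 0 ≤ ff φ l := integral_nonneg fun _ => le_max_right _ _

lemma grad_zero_of_min {N : Euc n → ℝ} (h : ∀ x, 0 ≤ N x) {x : Euc n} (hx : N x = 0) :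
    gradient N x = 0 := by
  have : IsLocalMin N x := Eventually.of_forall fun y => by rw [hx]; exact h y
  simp [gradient, this.fderiv_eq_zero]

lemma integrable_ff_test {Ω : Set (Euc n)} {φ : Euc n → ℝ} (h : IsTestFun Ω φ) {l : ℝ} (hl : 0 ≤ l) :
    Integrable (fun x => max (φ x - l) 0) := by
  have hc : Continuous φ := h.1.continuous
  refine Continuous.integrable_of_hasCompactSupport (by fun_prop) ?_
  exact h.2.1.comp_left (g := fun s => max (s - l) 0) (by simp [hl])

lemma vol_le_of_integral {S : Set (Euc n)} (hS : MeasurableSet S) {g : Euc n → ℝ}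
    (hg : Integrable g) (hg0 : ∀ x, 0 ≤ g x) {c : ℝ} (hc : 0 < c) (h : ∀ x ∈ S, c ≤ g x) :
    volume S ≤ ENNReal.ofReal ((∫ x, g x) / c) := by
  have h1 : ENNReal.ofReal c * volume S ≤ ENNReal.ofReal (∫ x, g x) := by
    rw [ofReal_integral_eq_lintegral_ofReal hg (Eventually.of_forall hg0), ← setLIntegral_const,
      ← lintegral_indicator hS]
    refine lintegral_mono fun x => ?_
    by_cases hx : x ∈ S
    · simp only [hx, indicator_of_mem]; exact ENNReal.ofReal_le_ofReal (h x hx)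
    · simp [hx]
  rw [ENNReal.ofReal_div_of_pos hc, ENNReal.le_div_iff_mul_le (by simp [hc]) (by simp)]
  rwa [mul_comm]

set_option maxHeartbeats 2000000 in
lemma trunc_test {C : ℝ} (hC : 0 < C) (hPT : PT n C) {Ω : Set (Euc n)}
    (hΩ : IsOpen Ω) {vmax : ℝ} (hv0 : 0 ≤ vmax) (hvol : volume Ω ≤ ENNReal.ofReal vmax)
    {q : LL n} {v : XX n} (hsol : Sol Ω q v) {σ M : ℝ} (hσ : 0 ≤ σ) (hM : 0 ≤ M)
    (hq : ∀ᵐ x, x ∈ Ω → q x ≤ σ * v.fst x + M)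
    {φ : Euc n → ℝ} (hφ : IsTestFun Ω φ) {ε : ℝ} (hε : 0 < ε) {l k : ℝ} (hl : 0 ≤ l) (hlk : l < k)
    (hsmall : σ * C * (‖(tx φ hφ).fst‖ ^ 2 / k ^ 2) ^ (2 / (n:ℝ)) ≤ 1 / 2) :
    (max (ff φ k - ε * vmax) 0) ^ 2 ≤ C * (ff φ l / (k - l)) ^ (1 + 2 / (n:ℝ)) *
      (2 * (σ * (k + ε) + M) * ff φ k + 2 * ((1 + σ) * (‖tx φ hφ - v‖ * ‖tx φ hφ‖))) := by
  have hk : 0 < k := hl.trans_lt hlk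
  obtain ⟨p, hp, hp0, hd0, hd1, hpε, hpn, hpm⟩ := exists_p ε hε
  have hpk : ContDiff ℝ (⊤ : ℕ∞) (fun s => p (s - k)) := hp.comp (by fun_prop)
  have hder : ∀ s, deriv (fun s => p (s - k)) s = deriv p (s - k) := fun s =>
    deriv_comp_sub_const p k s
  set N : Euc n → ℝ := fun x => p (φ x - k) with hN
  have hNt : IsTestFun Ω N := hφ.comp hpk (hp0 _ (by linarith))
  have hNg : ∀ x, gradient N x = deriv p (φ x - k) • gradient φ x := fun x => by
    rw [← hder]; exact hφ.grad_comp hpk x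
  have hN0 : ∀ x, 0 ≤ N x := fun x => hpn _
  have hNle : ∀ x, N x ≤ max (φ x - k) 0 := fun x => hpm _
  have hNabs : ∀ x, |N x| ≤ |φ x| := fun x => by
    rw [abs_of_nonneg (hN0 x)]
    refine (hNle x).trans (max_le ?_ (abs_nonneg _))
    linarith [le_abs_self (φ x)]
  set S : Set (Euc n) := {x | k < φ x} with hS
  have hSm : MeasurableSet S := (isOpen_lt continuous_const hφ.1.continuous).measurableSet
  have hNS : ∀ x ∉ S, N x = 0 := fun x hx => hp0 _ (by
    simp only [hS, mem_ofPred_eq, not_lt] at hx; linarith)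
  have hNSg : ∀ x ∉ S, gradient N x = 0 := fun x hx => grad_zero_of_min hN0 (hNS x hx)
  have hφ2 : ‖(tx φ hφ).fst‖ ^ 2 = ∫ x, φ x ^ 2 := by
    rw [tx_fst, norm_toLp_sq]; simp
  have hN2 : ‖(tx N hNt).fst‖ ^ 2 = ∫ x, N x ^ 2 := by
    rw [tx_fst, norm_toLp_sq]; simp
  have hE2 : ‖(tx N hNt).snd‖ ^ 2 = ∫ x, ‖gradient N x‖ ^ 2 := by
    rw [tx_snd, norm_toLp_sq]
  have hvol1 : volume S ≤ ENNReal.ofReal (ff φ l / (k - l)) := by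
    refine vol_le_of_integral hSm (integrable_ff_test hφ hl) (fun x => le_max_right _ _)
      (by linarith) fun x hx => ?_
    simp only [hS, mem_ofPred_eq] at hx
    exact le_max_of_le_left (by linarith)
  have hvol2 : volume S ≤ ENNReal.ofReal (‖(tx φ hφ).fst‖ ^ 2 / k ^ 2) := by
    rw [hφ2]
    refine vol_le_of_integral hSm (hφ.memLp 2).integrable_sq (fun x => by positivity)
      (by positivity) fun x hx => ?_
    simp only [hS, mem_ofPred_eq] at hx
    gcongr
  have hm1 : 0 ≤ ff φ l / (k - l) := div_nonneg (ff_nonneg _ _) (by linarith)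
  have I3 := (hPT N S Ω _ hNt hSm hNS hNSg hvol1 hm1).1
  have I2 := (hPT N S Ω _ hNt hSm hNS hNSg hvol2 (by positivity)).2
  set E := ∫ x, ‖gradient N x‖ ^ 2 with hEd
  set a := ∫ x, |N x| with had
  have hE0 : 0 ≤ E := integral_nonneg fun _ => by positivity
  have hNint : Integrable N := memLp_one_iff_integrable.1 (hNt.memLp 1)
  have ha_up : a ≤ ff φ k := by
    refine integral_mono hNint.abs (integrable_ff_test hφ hk.le) fun x => ?_
    simp only
    rw [abs_of_nonneg (hN0 x)]; exact hNle x
  have ha0 : 0 ≤ a := integral_nonneg fun _ => abs_nonneg _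
  have hfin : volume Ω ≠ ⊤ := (hvol.trans_lt ENNReal.ofReal_lt_top).ne
  have ha_lo : ff φ k - ε * vmax ≤ a := by
    have hind : Integrable (Ω.indicator fun _ => ε) :=
      (integrable_indicator_iff hΩ.measurableSet).2 (integrableOn_const hfin)
    have : ff φ k ≤ ∫ x, (|N x| + Ω.indicator (fun _ => ε) x) := by
      refine integral_mono (integrable_ff_test hφ hk.le) (hNint.abs.add hind) fun x => ?_
      simp only
      rw [abs_of_nonneg (hN0 x)]
      by_cases hx : x ∈ Ω
      · simp only [hx, indicator_of_mem]
        refine max_le ?_ (by linarith [hN0 x])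
        have := hpε (φ x - k)
        simp only [hN]; linarith
      · simp only [hx, not_false_eq_true, indicator_of_notMem, add_zero, hφ.zero_off hx]
        exact max_le (by linarith [hN0 x]) (hN0 x)
    rw [integral_add hNint.abs hind, integral_indicator hΩ.measurableSet] at this
    simp only [integral_const, smul_eq_mul, measureReal_restrict_apply_univ] at this
    have h2 : volume.real Ω ≤ vmax := ENNReal.toReal_le_of_le_ofReal hv0 hvol
    nlinarith
  -- energy inequality
  have I1 : E ≤ inner ℝ q (tx N hNt).fst + ‖tx φ hφ - v‖ * ‖tx φ hφ‖ := by
    have e1 : E ≤ inner ℝ (tx φ hφ).snd (tx N hNt).snd := by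
      rw [tx_snd, tx_snd, inner_toLp]
      have hint := L2.integrable_inner (𝕜 := ℝ) (tx φ hφ).snd (tx N hNt).snd
      refine integral_mono (hNt.memLp_grad 2).norm.integrable_sq (hint.congr ?_) ?_
      · filter_upwards [(hφ.memLp_grad 2).coeFn_toLp, (hNt.memLp_grad 2).coeFn_toLp] with x h1 h2
        rw [tx_snd, tx_snd, h1, h2]
      · intro x
        simp only [hNg]
        rw [norm_smul, real_inner_smul_right, real_inner_self_eq_norm_sq, mul_pow,
          Real.norm_of_nonneg (hd0 _)]
        have h1 := hd0 (φ x - k)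
        have h2 := hd1 (φ x - k)
        have h3 : deriv p (φ x - k) ^ 2 ≤ deriv p (φ x - k) := by nlinarith
        gcongr
    have e2 : inner ℝ (tx φ hφ).snd (tx N hNt).snd = inner ℝ q (tx N hNt).fst +
        inner ℝ (tx φ hφ - v).snd (tx N hNt).snd := by
      rw [← hsol.2 _ (tx_mem hNt), ← inner_add_left, WithLp.sub_snd]
      congr 1; abel
    have e3 : ‖(tx N hNt).snd‖ ≤ ‖(tx φ hφ).snd‖ := by
      refine le_of_pow_le_pow_left₀ two_ne_zero (norm_nonneg _) ?_
      rw [hE2, tx_snd, norm_toLp_sq]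
      refine integral_mono (hNt.memLp_grad 2).norm.integrable_sq
        (hφ.memLp_grad 2).norm.integrable_sq fun x => ?_
      simp only [hNg]
      rw [norm_smul, Real.norm_of_nonneg (hd0 _)]
      have h1 := hd0 (φ x - k)
      have h2 : deriv p (φ x - k) * ‖gradient φ x‖ ≤ ‖gradient φ x‖ :=
        mul_le_of_le_one_left (norm_nonneg _) (hd1 _)
      gcongr
    have e4 : inner ℝ (tx φ hφ - v).snd (tx N hNt).snd ≤ ‖tx φ hφ - v‖ * ‖tx φ hφ‖ := by
      refine (real_inner_le_norm _ _).trans ?_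
      gcongr
      · exact normX_snd_le _
      · exact e3.trans (normX_snd_le _)
    linarith
  have I4 : inner ℝ q (tx N hNt).fst ≤ σ * (∫ x, N x ^ 2) + (σ * (k + ε) + M) * a +
      σ * (‖tx φ hφ - v‖ * ‖tx φ hφ‖) := by
    have e1 : inner ℝ q (tx N hNt).fst ≤
        σ * (∫ x, N x ^ 2) + (σ * (k + ε) + M) * a + σ * inner ℝ (v - tx φ hφ).fst (tx N hNt).fst := by
      rw [real_inner_eq, real_inner_eq, ← integral_const_mul, ← integral_const_mul,
        ← integral_const_mul, ← integral_add, ← integral_add]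
      · refine integral_mono_ae (integrable_mulL _ _) (((((hNt.memLp 2).integrable_sq).const_mul _).add
          (hNint.abs.const_mul _)).add ((integrable_mulL _ _).const_mul _)) ?_
        filter_upwards [hq, (hφ.memLp 2).coeFn_toLp, (hNt.memLp 2).coeFn_toLp,
          Lp.coeFn_sub v.fst (tx φ hφ).fst] with x h1 h2 h3 h4
        rw [WithLp.sub_fst, h4, Pi.sub_apply, tx_fst, tx_fst, h2, h3, abs_of_nonneg (hN0 x)]
        by_cases hx : x ∈ Ω
        · have h5 := mul_le_mul_of_nonneg_right (h1 hx) (hN0 x)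
          have h6 : φ x ≤ N x + k + ε := by
            have := hpε (φ x - k)
            simp only [hN]; linarith
          have h7 := mul_le_mul_of_nonneg_left (mul_le_mul_of_nonneg_right h6 (hN0 x)) hσ
          nlinarith
        · rw [hNt.zero_off hx]; simp
      · exact (((hNt.memLp 2).integrable_sq).const_mul _).add (hNint.abs.const_mul _)
      · exact (integrable_mulL _ _).const_mul _
      · exact ((hNt.memLp 2).integrable_sq).const_mul _
      · exact hNint.abs.const_mul _
    have e3 : ‖(tx N hNt).fst‖ ≤ ‖(tx φ hφ).fst‖ := by
      refine le_of_pow_le_pow_left₀ two_ne_zero (norm_nonneg _) ?_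
      rw [hN2, hφ2]
      refine integral_mono (hNt.memLp 2).integrable_sq (hφ.memLp 2).integrable_sq fun x => ?_
      exact sq_le_sq.2 (hNabs x)
    have e4 : inner ℝ (v - tx φ hφ).fst (tx N hNt).fst ≤ ‖tx φ hφ - v‖ * ‖tx φ hφ‖ := by
      refine (real_inner_le_norm _ _).trans ?_
      rw [norm_sub_rev (tx φ hφ) v]
      gcongr
      · exact normX_fst_le _
      · exact e3.trans (normX_fst_le _)
    have := mul_le_mul_of_nonneg_left e4 hσ
    linarith
  set δ := ‖tx φ hφ - v‖ * ‖tx φ hφ‖ with hδ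
  have hδ0 : 0 ≤ δ := by positivity
  have I5 : σ * (∫ x, N x ^ 2) ≤ 1 / 2 * E := by
    have h1 := mul_le_mul_of_nonneg_left I2 hσ
    have h2 := mul_le_mul_of_nonneg_right hsmall hE0
    nlinarith
  have hcoef : 0 ≤ σ * (k + ε) + M := by positivity
  have I6 : E ≤ 2 * (σ * (k + ε) + M) * ff φ k + 2 * ((1 + σ) * δ) := by
    have := mul_le_mul_of_nonneg_left ha_up hcoef
    nlinarith
  calc (max (ff φ k - ε * vmax) 0) ^ 2 ≤ a ^ 2 := by
        gcongr
        exact max_le ha_lo ha0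
    _ ≤ _ := I3
    _ ≤ _ := by gcongr



lemma HH_L1 {Ω : Set (Euc n)} (hΩ : MeasurableSet Ω) {vmax : ℝ} (hv0 : 0 ≤ vmax)
    (hvol : volume Ω ≤ ENNReal.ofReal vmax) {x : XX n} (hx : x ∈ HH Ω) :
    Integrable x.fst ∧ ∫ y, |x.fst y| ≤ √vmax * ‖x.fst‖ := by
  have hfin : volume Ω ≠ ⊤ := (hvol.trans_lt ENNReal.ofReal_lt_top).ne
  have h0 := HH_zero_off hΩ hx
  have hind : MemLp (Ω.indicator fun _ => (1:ℝ)) 2 volume := memLp_indicator_const 2 hΩ 1 (Or.inr hfin)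
  have hmem : MemLp x.fst 2 volume := Lp.memLp _
  have hI : Integrable x.fst := by
    have h1 := integrable_mulL (oneL Ω hΩ hfin) x.fst
    refine h1.congr ?_
    filter_upwards [h0, oneL_ae Ω hΩ hfin] with y h1 h2
    rw [h2]
    by_cases hy : y ∈ Ω
    · simp [hy]
    · simp [hy, h1 hy]
  refine ⟨hI, ?_⟩
  have h2 := cs_mul hind hmem.norm
  have e1 : ∫ y, Ω.indicator (fun _ => (1:ℝ)) y * ‖x.fst y‖ = ∫ y, |x.fst y| := by
    refine integral_congr_ae ?_
    filter_upwards [h0] with y h1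
    by_cases hy : y ∈ Ω
    · simp [hy]
    · simp [hy, h1 hy]
  have e2 : (∫ x, Ω.indicator (fun _ => (1:ℝ)) x ^ 2) ≤ vmax := by
    have : (fun x => Ω.indicator (fun _ => (1:ℝ)) x ^ 2) = Ω.indicator (fun _ => (1:ℝ)) := by
      funext x
      by_cases hx : x ∈ Ω <;> simp [hx]
    rw [this, integral_indicator hΩ]
    simp only [integral_const, smul_eq_mul, mul_one]
    rw [measureReal_restrict_apply_univ]
    exact ENNReal.toReal_le_of_le_ofReal hv0 hvol
  rw [e1, ← norm_Lp_sq] at h2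
  refine le_of_pow_le_pow_left₀ two_ne_zero (by positivity) (h2.trans ?_)
  rw [mul_pow, Real.sq_sqrt hv0]
  gcongr

lemma integrable_ff {v : Euc n → ℝ} (hv : Integrable v) {l : ℝ} (hl : 0 ≤ l) :
    Integrable (fun x => max (v x - l) 0) := by
  refine hv.mono (by have := hv.1; fun_prop) (Eventually.of_forall fun x => ?_)
  rw [Real.norm_eq_abs, Real.norm_eq_abs, abs_of_nonneg (le_max_right _ _)]
  exact max_le (by linarith [le_abs_self (v x)]) (abs_nonneg _)

lemma ff_tendsto {Ω : Set (Euc n)} (hΩ : MeasurableSet Ω) {vmax : ℝ} (hv0 : 0 ≤ vmax)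
    (hvol : volume Ω ≤ ENNReal.ofReal vmax) {v : XX n} (hv : v ∈ HH Ω)
    {φ : ℕ → Euc n → ℝ} (hφ : ∀ k, IsTestFun Ω (φ k))
    (hlim : Tendsto (fun k => tx (φ k) (hφ k)) atTop (𝓝 v)) {l : ℝ} (hl : 0 ≤ l) :
    Tendsto (fun k => ff (φ k) l) atTop (𝓝 (ff v.fst l)) := by
  rw [tendsto_iff_norm_sub_tendsto_zero] at hlim ⊢
  have h2 := hlim.const_mul (√vmax)
  rw [mul_zero] at h2
  refine squeeze_zero (fun _ => norm_nonneg _) (fun k => ?_) h2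
  have hv1 := (HH_L1 hΩ hv0 hvol hv).1
  have hd := HH_L1 hΩ hv0 hvol (Submodule.sub_mem _ (tx_mem (hφ k)) hv)
  have hle : ∫ y, |(tx (φ k) (hφ k) - v).fst y| ≤ √vmax * ‖tx (φ k) (hφ k) - v‖ :=
    hd.2.trans (by gcongr; exact normX_fst_le _)
  refine le_trans ?_ hle
  unfold ff
  rw [← integral_sub (integrable_ff_test (hφ k) hl) (integrable_ff hv1 hl)]
  refine (norm_integral_le_integral_norm _).trans ?_
  refine integral_mono_ae ((integrable_ff_test (hφ k) hl).sub (integrable_ff hv1 hl)).norm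
    hd.1.abs ?_
  filter_upwards [((hφ k).memLp 2).coeFn_toLp, Lp.coeFn_sub (tx (φ k) (hφ k)).fst v.fst] with y h1 h2
  rw [WithLp.sub_fst, h2, Pi.sub_apply, tx_fst, h1, Real.norm_eq_abs]
  refine (abs_max_sub_max_le_abs _ _ _).trans ?_
  rw [sub_sub_sub_cancel_right]

lemma step {C : ℝ} (hC : 0 < C) (hPT : PT n C) {Ω : Set (Euc n)}
    (hΩ : IsOpen Ω) {vmax : ℝ} (hv0 : 0 ≤ vmax) (hvol : volume Ω ≤ ENNReal.ofReal vmax)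
    {q : LL n} {v : XX n} (hsol : Sol Ω q v) {σ M : ℝ} (hσ : 0 ≤ σ) (hM : 0 ≤ M)
    (hq : ∀ᵐ x, x ∈ Ω → q x ≤ σ * v.fst x + M) {l k : ℝ} (hl : 0 ≤ l) (hlk : l < k)
    (hsmall : σ * C * (‖v.fst‖ ^ 2 / k ^ 2) ^ (2 / (n:ℝ)) < 1 / 2) :
    ff v.fst k ≤ 2 * C * (σ * k + M) * (ff v.fst l / (k - l)) ^ (1 + 2 / (n:ℝ)) := by
  have hk : 0 < k := hl.trans_lt hlk
  obtain ⟨φ, hφ, hlim⟩ := HH_approx hsol.1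
  have lk := ff_tendsto hΩ.measurableSet hv0 hvol hsol.1 hφ hlim hk.le
  have ll := ff_tendsto hΩ.measurableSet hv0 hvol hsol.1 hφ hlim hl
  have l0 : Tendsto (fun j => ‖tx (φ j) (hφ j) - v‖ * ‖tx (φ j) (hφ j)‖) atTop (𝓝 0) := by
    have := (tendsto_iff_norm_sub_tendsto_zero.1 hlim).mul hlim.norm
    rwa [zero_mul] at this
  have ls : Tendsto (fun j => σ * C * (‖(tx (φ j) (hφ j)).fst‖ ^ 2 / k ^ 2) ^ (2 / (n:ℝ))) atTop
      (𝓝 (σ * C * (‖v.fst‖ ^ 2 / k ^ 2) ^ (2 / (n:ℝ)))) :=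
    (((((cont_fst.tendsto v).comp hlim).norm.pow 2).div_const _).rpow_const
      (Or.inr (by positivity))).const_mul _
  have hev : ∀ᶠ j in atTop, σ * C * (‖(tx (φ j) (hφ j)).fst‖ ^ 2 / k ^ 2) ^ (2 / (n:ℝ)) ≤ 1 / 2 :=
    (ls.eventually (gt_mem_nhds hsmall)).mono fun _ h => h.le
  have hε : ∀ ε : ℝ, 0 < ε → (max (ff v.fst k - ε * vmax) 0) ^ 2 ≤
      C * (ff v.fst l / (k - l)) ^ (1 + 2 / (n:ℝ)) *
      (2 * (σ * (k + ε) + M) * ff v.fst k + 2 * ((1 + σ) * 0)) := by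
    intro ε hε
    refine le_of_tendsto_of_tendsto (((lk.sub_const _).max tendsto_const_nhds).pow 2)
      ((((ll.div_const _).rpow_const (Or.inr (by positivity))).const_mul C).mul
        ((lk.const_mul _).add ((l0.const_mul _).const_mul 2))) ?_
    filter_upwards [hev] with j hj
    exact trunc_test hC hPT hΩ hv0 hvol hsol hσ hM hq (hφ j) hε hl hlk hj
  set F := ff v.fst k with hF
  set Q := (ff v.fst l / (k - l)) ^ (1 + 2 / (n:ℝ)) with hQ
  have hF0 : 0 ≤ F := ff_nonneg _ _
  have hQ0 : 0 ≤ Q := Real.rpow_nonneg (div_nonneg (ff_nonneg _ _) (by linarith)) _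
  have hfinal : F ^ 2 ≤ C * Q * (2 * (σ * k + M) * F) := by
    have c1 : Tendsto (fun ε : ℝ => (max (F - ε * vmax) 0) ^ 2) (𝓝[>] 0) (𝓝 ((max (F - 0 * vmax) 0) ^ 2)) :=
      (Continuous.tendsto (by fun_prop) 0).mono_left nhdsWithin_le_nhds
    have c2 : Tendsto (fun ε : ℝ => C * Q * (2 * (σ * (k + ε) + M) * F + 2 * ((1 + σ) * 0))) (𝓝[>] 0)
        (𝓝 (C * Q * (2 * (σ * (k + 0) + M) * F + 2 * ((1 + σ) * 0)))) :=
      (Continuous.tendsto (by fun_prop) 0).mono_left nhdsWithin_le_nhds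
    have := le_of_tendsto_of_tendsto c1 c2 (by
      filter_upwards [self_mem_nhdsWithin] with ε hε'
      exact hε ε hε')
    simpa [max_eq_left hF0] using this
  rcases hF0.eq_or_lt with h | h
  · rw [← h]; positivity
  · have : F * F ≤ F * (2 * C * (σ * k + M) * Q) := by nlinarith
    exact le_of_mul_le_mul_left this h

lemma iter {F : ℝ → ℝ} (hF0 : ∀ k, 0 ≤ F k) {D β k1 r : ℝ} (hD : 0 < D) (hβ : 0 < β) (hk1 : 0 < k1)
    (hr0 : 0 < r) (hr1 : r < 1) (hrb : r ^ β = ((2:ℝ) ^ (1 + β))⁻¹)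
    (hmono : ∀ l k, k1 ≤ l → l ≤ k → F k ≤ F l)
    (hstep : ∀ l k, k1 ≤ l → l < k → k ≤ 2 * k1 → F k ≤ D * k1 * (F l / (k - l)) ^ (1 + β))
    (hsm : D * (F k1 / k1) ^ β * (2:ℝ) ^ (1 + β) ≤ r) : F (2 * k1) = 0 := by
  set b := (2:ℝ) ^ (1 + β) with hb
  have hb0 : 0 < b := by positivity
  set a0 := F k1 / k1 with ha0
  have ha00 : 0 ≤ a0 := div_nonneg (hF0 _) hk1.le
  set kk : ℕ → ℝ := fun j => k1 * (2 - (1/2) ^ j) with hkk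
  have hpos : ∀ j : ℕ, (0:ℝ) < (1/2) ^ j := fun j => by positivity
  have hle1 : ∀ j : ℕ, ((1:ℝ)/2) ^ j ≤ 1 := fun j => pow_le_one₀ (by norm_num) (by norm_num)
  have hk_ge : ∀ j, k1 ≤ kk j := fun j => by
    simp only [hkk]; nlinarith [hle1 j]
  have hk_le : ∀ j, kk j ≤ 2 * k1 := fun j => by
    simp only [hkk]; nlinarith [hpos j]
  have hdiff : ∀ j, kk (j+1) - kk j = k1 * (1/2) ^ (j+1) := fun j => by
    simp only [hkk]; ring
  have claim : ∀ j, F (kk j) ≤ k1 * (a0 * r ^ j) := by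
    intro j
    induction j with
    | zero => simp [hkk, ha0]; field_simp; norm_num
    | succ j ih =>
      have hd := hdiff j
      have hlt : kk j < kk (j+1) := by
        have : 0 < k1 * (1/2) ^ (j+1) := by positivity
        linarith
      refine (hstep _ _ (hk_ge j) hlt (hk_le _)).trans ?_
      have h1 : F (kk j) / (kk (j+1) - kk j) ≤ a0 * r ^ j * 2 ^ (j+1) := by
        rw [hd, div_le_iff₀ (by positivity)]
        refine ih.trans (le_of_eq ?_)
        have : (2:ℝ) ^ (j+1) * (1/2) ^ (j+1) = 1 := by rw [← mul_pow]; norm_num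
        linear_combination (-(a0 * r ^ j * k1)) * this
      have h1n : 0 ≤ F (kk j) / (kk (j+1) - kk j) := div_nonneg (hF0 _) (by linarith)
      have h2 : (F (kk j) / (kk (j+1) - kk j)) ^ (1 + β) ≤ (a0 * r ^ j * 2 ^ (j+1)) ^ (1 + β) := by
        gcongr
      have e1 : (a0 * r ^ j * 2 ^ (j+1)) ^ (1 + β) = a0 * a0 ^ β * r ^ j * b := by
        rw [Real.mul_rpow (by positivity) (by positivity), Real.mul_rpow ha00 (by positivity),
          Real.rpow_add' ha00 (by positivity), Real.rpow_one,
          Real.rpow_add' (by positivity : (0:ℝ) ≤ r ^ j) (by positivity), Real.rpow_one,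
          ← Real.rpow_pow_comm hr0.le, hrb, ← Real.rpow_pow_comm (by norm_num), ← hb, pow_succ]
        rw [inv_pow]; field_simp
      rw [e1] at h2
      calc D * k1 * (F (kk j) / (kk (j+1) - kk j)) ^ (1 + β)
          ≤ D * k1 * (a0 * a0 ^ β * r ^ j * b) := by gcongr
        _ = k1 * a0 * r ^ j * (D * a0 ^ β * b) := by ring
        _ ≤ k1 * a0 * r ^ j * r := by gcongr
        _ = _ := by ring
  have hlim : Tendsto (fun j : ℕ => k1 * (a0 * r ^ j)) atTop (𝓝 (k1 * (a0 * 0))) :=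
    ((tendsto_pow_atTop_nhds_zero_of_lt_one hr0.le hr1).const_mul _).const_mul _
  rw [mul_zero, mul_zero] at hlim
  refine le_antisymm (ge_of_tendsto' hlim fun j => ?_) (hF0 _)
  exact (hmono _ _ (hk_ge j) (hk_le j)).trans (claim j)

lemma Linf (hn : 2 ≤ n) (vmax σ0 M B : ℝ) (hv0 : 0 < vmax) (hσ0 : 0 ≤ σ0) (hM : 0 < M) (hB : 0 ≤ B) :
    ∃ K : ℝ, 0 < K ∧ ∀ Ω : Set (Euc n), IsOpen Ω → volume Ω ≤ ENNReal.ofReal vmax →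
      ∀ σ, 0 ≤ σ → σ ≤ σ0 → ∀ (q : LL n) (v : XX n), Sol Ω q v →
      (∀ᵐ x, x ∈ Ω → q x ≤ σ * v.fst x + M) → ‖v.fst‖ ≤ B → ∀ᵐ x, v.fst x ≤ K := by
  obtain ⟨C, hC, hPT⟩ := poincare_test hn
  have hn0 : (0:ℝ) < n := by exact_mod_cast (by omega : 0 < n)
  set β := 2 / (n:ℝ) with hβd
  have hβ : 0 < β := by positivity
  set b := (2:ℝ) ^ (1 + β) with hb
  have hb1 : 1 < b := Real.one_lt_rpow (by norm_num) (by positivity)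
  set r := (b⁻¹) ^ (β⁻¹) with hr
  have hr0 : 0 < r := by positivity
  have hr1 : r < 1 := Real.rpow_lt_one (by positivity) (inv_lt_one_of_one_lt₀ hb1) (by positivity)
  have hrb : r ^ β = b⁻¹ := by
    rw [hr, ← Real.rpow_mul (by positivity), inv_mul_cancel₀ hβ.ne', Real.rpow_one]
  set D := 2 * C * (2 * σ0 + M) with hD
  have hD0 : 0 < D := by positivity
  have t1 : Tendsto (fun k : ℝ => σ0 * C * (B ^ 2 / k ^ 2) ^ β) atTop (𝓝 (σ0 * C * 0 ^ β)) := by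
    refine Tendsto.const_mul _ (Tendsto.rpow_const ?_ (Or.inr hβ.le))
    exact tendsto_const_nhds.div_atTop (tendsto_pow_atTop two_ne_zero)
  have t2 : Tendsto (fun k : ℝ => D * (√vmax * B / k) ^ β * b) atTop (𝓝 (D * 0 ^ β * b)) := by
    refine Tendsto.mul_const _ (Tendsto.const_mul _ (Tendsto.rpow_const ?_ (Or.inr hβ.le)))
    exact tendsto_const_nhds.div_atTop tendsto_id
  rw [Real.zero_rpow hβ.ne', mul_zero] at t1 t2
  rw [zero_mul] at t2
  obtain ⟨k1, hk1, h1, h2⟩ := ((eventually_ge_atTop (1:ℝ)).and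
    ((t1.eventually (gt_mem_nhds (by norm_num : (0:ℝ) < 1/2))).and (t2.eventually (gt_mem_nhds hr0)))).exists
  have hk0 : 0 < k1 := by linarith
  refine ⟨2 * k1, by positivity, ?_⟩
  intro Ω hΩ hvol σ hσ hσσ q v hsol hq hvB
  have hL1 := HH_L1 hΩ.measurableSet hv0.le hvol hsol.1
  have hff : ff v.fst (2 * k1) = 0 := by
    refine iter (F := ff v.fst) (fun _ => ff_nonneg _ _) hD0 hβ hk0 hr0 hr1 hrb ?_ ?_ ?_
    · intro l k hl hlk
      refine integral_mono (integrable_ff hL1.1 (by linarith)) (integrable_ff hL1.1 (by linarith))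
        fun x => ?_
      exact max_le_max (by linarith) le_rfl
    · intro l k hl hlk hk2
      have hQ : 0 ≤ (ff v.fst l / (k - l)) ^ (1 + β) :=
        Real.rpow_nonneg (div_nonneg (ff_nonneg _ _) (by linarith)) _
      refine (step hC hPT hΩ hv0.le hvol hsol hσ hM.le hq (by linarith) hlk ?_).trans ?_
      · refine lt_of_le_of_lt ?_ h1
        have : k1 ≤ k := by linarith
        gcongr
      · refine mul_le_mul_of_nonneg_right ?_ hQ
        have : σ * k + M ≤ (2 * σ0 + M) * k1 := by nlinarith
        rw [hD]
        nlinarith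
    · refine le_trans ?_ h2.le
      have : ff v.fst k1 ≤ √vmax * B := by
        refine le_trans ?_ (hL1.2.trans (by gcongr))
        refine integral_mono (integrable_ff hL1.1 hk0.le) hL1.1.abs fun x => ?_
        exact max_le (by linarith [le_abs_self (v.fst x)]) (abs_nonneg _)
      have := ff_nonneg (v.fst) k1
      gcongr
  unfold ff at hff
  have hff := (integral_eq_zero_iff_of_nonneg
    (fun x => (le_max_right _ _ : (0:ℝ) ≤ max (v.fst x - 2 * k1) 0))
    (integrable_ff hL1.1 (by linarith))).1 hff
  filter_upwards [hff] with x hx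
  have : v.fst x - 2 * k1 ≤ max (v.fst x - 2 * k1) 0 := le_max_left _ _
  rw [hx] at this
  simp at this
  linarith



lemma lam1_nonneg (Ω : Set (Euc n)) : 0 ≤ lam1 Ω := by
  refine Real.sInf_nonneg ?_
  rintro r ⟨u, Du, -, -, rfl⟩
  exact div_nonneg (integral_nonneg fun _ => by positivity) (integral_nonneg fun _ => by positivity)

lemma rayleigh {Ω : Set (Euc n)} {x : XX n} (hx : x ∈ HH Ω) :
    lam1 Ω * ‖x.fst‖ ^ 2 ≤ ‖x.snd‖ ^ 2 := by
  by_cases h0 : ‖x.fst‖ ^ 2 = 0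
  · rw [h0, mul_zero]; positivity
  have hpos : 0 < ‖x.fst‖ ^ 2 := lt_of_le_of_ne (by positivity) (Ne.symm h0)
  rw [← le_div_iff₀ hpos]
  refine csInf_le ⟨0, ?_⟩ ⟨x.fst, x.snd, HH_memH10 hx, ?_, ?_⟩
  · rintro r ⟨u, Du, -, -, rfl⟩
    exact div_nonneg (integral_nonneg fun _ => by positivity)
      (integral_nonneg fun _ => by positivity)
  · rw [norm_Lp_sq] at h0
    simpa using h0
  · rw [norm_Lp_sq, norm_Lp_sq]; simp

lemma eigen_sol {Ω : Set (Euc n)} {U : XX n} (hU : U ∈ HH Ω) (h1 : ‖U.fst‖ ^ 2 = 1)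
    (h2 : ‖U.snd‖ ^ 2 = lam1 Ω) : Sol Ω (lam1 Ω • U.fst) U := by
  refine ⟨hU, fun y hy => ?_⟩
  rw [real_inner_smul_left]
  have hB := rayleigh hy
  have key : ∀ t : ℝ, 0 ≤ 2 * t * (inner ℝ U.snd y.snd - lam1 Ω * inner ℝ U.fst y.fst) +
      t ^ 2 * (‖y.snd‖ ^ 2 - lam1 Ω * ‖y.fst‖ ^ 2) := by
    intro t
    have := rayleigh (Submodule.add_mem _ hU (Submodule.smul_mem _ t hy))
    rw [WithLp.add_fst, WithLp.add_snd, WithLp.smul_fst, WithLp.smul_snd, norm_add_sq_real,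
      norm_add_sq_real, real_inner_smul_right, real_inner_smul_right, norm_smul, norm_smul,
      mul_pow, mul_pow, h1, h2] at this
    simp only [Real.norm_eq_abs, sq_abs] at this
    linarith
  set A := inner ℝ U.snd y.snd - lam1 Ω * inner ℝ U.fst y.fst with hA
  set B := ‖y.snd‖ ^ 2 - lam1 Ω * ‖y.fst‖ ^ 2 with hBd
  have hB0 : 0 ≤ B := by linarith
  have h := key (-A / (B + 1))
  have e : 2 * (-A / (B + 1)) * A + (-A / (B + 1)) ^ 2 * B = - (A ^ 2 * (B + 2) / (B + 1) ^ 2) := by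
    field_simp; ring
  rw [e] at h
  have hA0 : A ^ 2 = 0 := by
    by_contra hne
    have : 0 < A ^ 2 := lt_of_le_of_ne (by positivity) (Ne.symm hne)
    have : 0 < A ^ 2 * (B + 2) / (B + 1) ^ 2 := by positivity
    linarith
  have : A = 0 := by simpa using hA0
  linarith

lemma tor_int {Ω Ω' : Set (Euc n)} (hs : Ω ⊆ Ω') (hΩ : MeasurableSet Ω) (hm : MeasurableSet Ω')
    (hf : volume Ω' ≠ ⊤) {w : Euc n → ℝ} {Dw : Euc n → Euc n} (h : MemH10 Ω w Dw) :
    ∫ x, ((1 / 2) * ‖Dw x‖ ^ 2 - w x) = JJ (oneL Ω' hm hf) (mkX w Dw h.1 h.2.1) := by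
  have hx := mkX_mem h
  set X := mkX w Dw h.1 h.2.1 with hX
  have e1 : ‖X.snd‖ ^ 2 = ∫ x, ‖Dw x‖ ^ 2 := norm_toLp_sq h.2.1
  have hae : (fun x => oneL Ω' hm hf x * X.fst x) =ᵐ[volume] w := by
    filter_upwards [oneL_ae Ω' hm hf, HH_zero_off hΩ hx, h.1.coeFn_toLp] with x h1 h2 h3
    have h4 : X.fst x = w x := h3
    rw [h1, h4]
    by_cases hy : x ∈ Ω'
    · simp [hy]
    · rw [← h4, h2 (fun h => hy (hs h))]; simp
  have hw : Integrable w := (integrable_mulL (oneL Ω' hm hf) X.fst).congr hae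
  unfold JJ
  rw [e1, real_inner_eq, integral_congr_ae hae, integral_sub (h.2.1.norm.integrable_sq.const_mul _) hw,
    integral_const_mul]

lemma tor_eq {Ω Ω' : Set (Euc n)} (hs : Ω ⊆ Ω') (hΩ : MeasurableSet Ω) (hm : MeasurableSet Ω')
    (hf : volume Ω' ≠ ⊤) {w : XX n} (hw : Sol Ω (oneL Ω' hm hf) w) :
    tor Ω = - (1 / 2) * inner ℝ (oneL Ω' hm hf) w.fst := by
  have hJ : JJ (oneL Ω' hm hf) w = - (1 / 2) * inner ℝ (oneL Ω' hm hf) w.fst := by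
    unfold JJ
    rw [← real_inner_self_eq_norm_sq, hw.2 w hw.1]; ring
  rw [← hJ]
  have hmem : JJ (oneL Ω' hm hf) w ∈ {r | ∃ w Dw, MemH10 Ω w Dw ∧
      r = ∫ x, ((1 / 2) * ‖Dw x‖ ^ 2 - w x)} := by
    refine ⟨w.fst, w.snd, HH_memH10 hw.1, ?_⟩
    rw [tor_int hs hΩ hm hf (HH_memH10 hw.1), mkX_self]
  have hlb : ∀ r ∈ {r | ∃ w Dw, MemH10 Ω w Dw ∧
      r = ∫ x, ((1 / 2) * ‖Dw x‖ ^ 2 - w x)}, JJ (oneL Ω' hm hf) w ≤ r := by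
    rintro r ⟨y, Dy, hy, rfl⟩
    rw [tor_int hs hΩ hm hf hy]
    exact hw.J_le (mkX_mem hy)
  exact le_antisymm (csInf_le ⟨_, hlb⟩ hmem) (le_csInf ⟨_, hmem⟩ hlb)

lemma inner_bound {Ω : Set (Euc n)} (hΩ : MeasurableSet Ω) {vmax : ℝ} (hv0 : 0 ≤ vmax)
    (hvol : volume Ω ≤ ENNReal.ofReal vmax) {F : LL n} (hF : ∀ᵐ x, |F x| ≤ 1)
    {y : XX n} (hy : y ∈ HH Ω) : |inner ℝ F y.fst| ≤ √vmax * ‖y.fst‖ := by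
  obtain ⟨h1, h2⟩ := HH_L1 hΩ hv0 hvol hy
  refine le_trans ?_ h2
  rw [real_inner_eq]
  refine (abs_integral_le_integral_abs).trans ?_
  refine integral_mono_ae (integrable_mulL _ _).abs h1.abs ?_
  filter_upwards [hF] with x hx
  rw [abs_mul]
  exact mul_le_of_le_one_left (abs_nonneg _) hx

lemma exists_h {Ω : Set (Euc n)} (hΩ : MeasurableSet Ω) {vmax : ℝ} (hv0 : 0 ≤ vmax)
    (hvol : volume Ω ≤ ENNReal.ofReal vmax) {C : ℝ} (hC : 0 < C)
    (hP : ∀ x ∈ HH Ω, ‖x.fst‖ ^ 2 ≤ C * ‖x.snd‖ ^ 2) {α l : ℝ} (hα : 0 < α) (hl : 0 ≤ l)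
    {U : XX n} (hU : Sol Ω (l • U.fst) U) (h1 : ‖U.fst‖ ^ 2 = 1)
    (hgap : ∀ y ∈ HH Ω, inner ℝ U.fst y.fst = 0 → (l + α) * ‖y.fst‖ ^ 2 ≤ ‖y.snd‖ ^ 2)
    {F : LL n} (hF : ∀ᵐ x, |F x| ≤ 1) :
    ∃ h : XX n, inner ℝ U.fst h.fst = 0 ∧ ‖h.fst‖ ≤ √vmax / α ∧
      Sol Ω (l • h.fst + (F - (inner ℝ F U.fst : ℝ) • U.fst)) h := by
  set K : Submodule ℝ (XX n) := HH Ω ⊓ ((innerSL ℝ U.fst).comp aX).ker with hKd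
  have hK : IsClosed (K : Set (XX n)) :=
    (isClosed_HH Ω).inter ((innerSL ℝ U.fst).comp aX).isClosed_ker
  have hKm : ∀ y, y ∈ K ↔ y ∈ HH Ω ∧ inner ℝ U.fst y.fst = 0 := fun y => Iff.rfl
  obtain ⟨h, hh, hs⟩ := solve_sub K hK l (α / ((l + α) * (C + 1))) (by positivity) (by
    intro x hx
    obtain ⟨hx1, hx2⟩ := (hKm x).1 hx
    have g1 := hgap x hx1 hx2
    have g2 := hP x hx1
    rw [normX_sq, div_mul_eq_mul_div, div_le_iff₀ (by positivity)]
    have g3 := mul_le_mul_of_nonneg_left g1 hl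
    have g4 : α * ‖x.snd‖ ^ 2 ≤ (‖x.snd‖ ^ 2 - l * ‖x.fst‖ ^ 2) * (l + α) := by nlinarith
    have g5 := mul_le_mul_of_nonneg_right g4 (by positivity : 0 ≤ C + 1)
    have g6 := mul_le_mul_of_nonneg_left g2 hα.le
    nlinarith) F
  obtain ⟨hhH, hh0⟩ := (hKm h).1 hh
  refine ⟨h, hh0, ?_, hhH, fun y hy => ?_⟩
  · have e1 := hs h hh
    rw [real_inner_self_eq_norm_sq, real_inner_self_eq_norm_sq] at e1
    have e2 := hgap h hhH hh0
    have e3 := (le_abs_self _).trans (inner_bound hΩ hv0 hvol hF hhH)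
    rw [le_div_iff₀ hα]
    by_contra hcon
    push Not at hcon
    have hne : 0 < ‖h.fst‖ := by
      by_contra h0
      have : ‖h.fst‖ = 0 := le_antisymm (not_lt.1 h0) (norm_nonneg _)
      rw [this, zero_mul] at hcon
      exact absurd hcon (not_lt.2 (Real.sqrt_nonneg _))
    nlinarith
  · have hb : y - (inner ℝ U.fst y.fst : ℝ) • U ∈ K := by
      refine (hKm _).2 ⟨Submodule.sub_mem _ hy (Submodule.smul_mem _ _ hU.1), ?_⟩
      rw [WithLp.sub_fst, WithLp.smul_fst, inner_sub_right, real_inner_smul_right,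
        real_inner_self_eq_norm_sq, h1]
      ring
    have e1 := hs _ hb
    have e2 := hU.2 h hhH
    rw [real_inner_smul_left, hh0, real_inner_comm] at e2
    rw [WithLp.sub_fst, WithLp.smul_fst, WithLp.sub_snd, WithLp.smul_snd, inner_sub_right,
      inner_sub_right, inner_sub_right, real_inner_smul_right, real_inner_smul_right,
      real_inner_smul_right, e2, real_inner_comm U.fst h.fst, hh0] at e1
    rw [inner_add_left, inner_sub_left, real_inner_smul_left, real_inner_smul_left]
    linarith

lemma Sol.comb {Ω : Set (Euc n)} {G G' : LL n} {w w' : XX n} (h : Sol Ω G w) (h' : Sol Ω G' w')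
    (a b : ℝ) : Sol Ω (a • G + b • G') (a • w + b • w') := by
  refine ⟨Submodule.add_mem _ (Submodule.smul_mem _ _ h.1) (Submodule.smul_mem _ _ h'.1),
    fun y hy => ?_⟩
  rw [WithLp.add_snd, WithLp.smul_snd, WithLp.smul_snd, inner_add_left, inner_add_left,
    real_inner_smul_left, real_inner_smul_left, real_inner_smul_left, real_inner_smul_left,
    h.2 y hy, h'.2 y hy]

lemma comb_ae (G G' : LL n) (a b : ℝ) :
    ∀ᵐ x, (a • G + b • G' : LL n) x = a * G x + b * G' x := by
  filter_upwards [Lp.coeFn_add (a • G) (b • G'), Lp.coeFn_smul a G, Lp.coeFn_smul b G'] with x h1 h2 h3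
  rw [h1, Pi.add_apply, h2, h3]; simp



lemma a_bound {Ω : Set (Euc n)} {α l L : ℝ} (hα : 0 < α) {U' U : XX n}
    (hU' : Sol Ω (l • U'.fst) U') (h1' : ‖U'.fst‖ ^ 2 = 1) (hU : U ∈ HH Ω)
    (h1 : ‖U.fst‖ ^ 2 = 1) (h2 : ‖U.snd‖ ^ 2 = L)
    (hgap : ∀ y ∈ HH Ω, inner ℝ U'.fst y.fst = 0 → (l + α) * ‖y.fst‖ ^ 2 ≤ ‖y.snd‖ ^ 2)
    (ha : 0 ≤ inner ℝ U'.fst U.fst) :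
    0 ≤ 1 - inner ℝ U'.fst U.fst ∧ α * (1 - inner ℝ U'.fst U.fst) ≤ L - l := by
  set a : ℝ := inner ℝ U'.fst U.fst with had
  have e1 := hU'.2 U hU
  have e2 := hU'.2 U' hU'.1
  rw [real_inner_smul_left, real_inner_self_eq_norm_sq, real_inner_self_eq_norm_sq, h1'] at e2
  rw [real_inner_smul_left, ← had] at e1
  have hz := hgap (U - a • U') (Submodule.sub_mem _ hU (Submodule.smul_mem _ _ hU'.1)) (by
    rw [WithLp.sub_fst, WithLp.smul_fst, inner_sub_right, real_inner_smul_right,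
        real_inner_self_eq_norm_sq, h1', ← had]
    ring)
  rw [WithLp.sub_fst, WithLp.smul_fst, WithLp.sub_snd, WithLp.smul_snd, norm_sub_sq_real,
    norm_sub_sq_real, real_inner_smul_right, real_inner_smul_right, norm_smul, norm_smul,
    mul_pow, mul_pow, h1, h2, h1', e2, real_inner_comm, ← had, real_inner_comm U'.snd, e1] at hz
  simp only [Real.norm_eq_abs, sq_abs] at hz
  have ha1 : a ≤ 1 := by
    have := abs_real_inner_le_norm U'.fst U.fst
    have n1 : ‖U'.fst‖ = 1 := by
      have := norm_nonneg U'.fst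
      nlinarith
    have n2 : ‖U.fst‖ = 1 := by
      have := norm_nonneg U.fst
      nlinarith
    rw [n1, n2, ← had] at this
    linarith [le_abs_self a]
  refine ⟨by linarith, ?_⟩
  have : α * (1 - a ^ 2) ≤ L - l := by nlinarith
  have : 0 ≤ α * (a * (1 - a)) := mul_nonneg hα.le (mul_nonneg ha (by linarith))
  nlinarith

lemma inner_nonneg_ae {G f : LL n} (hG : ∀ᵐ x, 0 ≤ G x) (h : ∀ᵐ x, 0 ≤ f x) :
    0 ≤ inner ℝ G f := by
  rw [real_inner_eq]
  refine integral_nonneg_of_ae ?_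
  filter_upwards [hG, h] with x h1 h2
  exact mul_nonneg h1 h2

/-- `μ(w') ≤ 2 λ K₁ (tor Ω - tor Ω')` -/
lemma mu_w_bound {Ω Ω' : Set (Euc n)} (hs : Ω ⊆ Ω') (hΩ : MeasurableSet Ω)
    (hm : MeasurableSet Ω') (hf : volume Ω' ≠ ⊤) {C : ℝ} (hC : 0 < C)
    (hP : ∀ x ∈ HH Ω', ‖x.fst‖ ^ 2 ≤ C * ‖x.snd‖ ^ 2)
    {L K1 : ℝ} (hL : 0 ≤ L) {U w w' : XX n} (hU : Sol Ω (L • U.fst) U)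
    (hK1 : ∀ᵐ x, U.fst x ≤ K1)
    (hw : Sol Ω (oneL Ω' hm hf) w) (hw' : Sol Ω' (oneL Ω' hm hf) w') :
    L * inner ℝ U.fst w'.fst - inner ℝ U.snd w'.snd ≤ 2 * L * K1 * (tor Ω - tor Ω') := by
  set I := oneL Ω' hm hf with hI
  rw [tor_eq hs hΩ hm hf hw, tor_eq le_rfl hm hm hf hw', ← hI]
  have e1 : inner ℝ U.snd w'.snd = L * inner ℝ U.fst w.fst := by
    rw [← real_inner_smul_left, ← hU.2 w hw.1, real_inner_comm, hw'.2 U (HH_mono hs hU.1),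
      ← hw.2 U hU.1, real_inner_comm]
  have hI0 : ∀ᵐ x, 0 ≤ I x := by
    filter_upwards [oneL_ae Ω' hm hf] with x hx
    rw [hx]; exact indicator_nonneg (fun _ _ => zero_le_one) x
  have hζ : ∀ᵐ x, 0 ≤ (K1 • I + (-1 : ℝ) • U.fst : LL n) x := by
    filter_upwards [comb_ae I U.fst K1 (-1), oneL_ae Ω' hm hf, hK1, HH_zero_off hΩ hU.1]
      with x h1 h2 h3 h4
    rw [h1, h2]
    by_cases hx : x ∈ Ω'
    · simp [hx]; exact h3
    · simp [hx, h4 (fun h => hx (hs h))]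
  obtain ⟨g, hg⟩ := exists_sol Ω' C hC hP (K1 • I + (-1 : ℝ) • U.fst : LL n)
  have hD := D_nonneg hs hm hf hP hI0 hζ hw hg
  rw [← hw'.2 g hg.1, real_inner_comm, real_inner_comm _ w'.snd, hg.2 w (HH_mono hs hw.1),
    hg.2 w' hw'.1] at hD
  rw [inner_add_left, inner_add_left, real_inner_smul_left, real_inner_smul_left,
    real_inner_smul_left, real_inner_smul_left] at hD
  rw [e1]
  have := mul_le_mul_of_nonneg_left hD hL
  linarith

/-- comparison of `μ(h)` with `μ(w')` -/
lemma mu_le {Ω Ω' : Set (Euc n)} (hs : Ω ⊆ Ω')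
    (hm : MeasurableSet Ω') (hf : volume Ω' ≠ ⊤) {C : ℝ}
    (hP : ∀ x ∈ HH Ω', ‖x.fst‖ ^ 2 ≤ C * ‖x.snd‖ ^ 2)
    {L K : ℝ} (hL : 0 ≤ L) {U h w' : XX n} (hU : Sol Ω (L • U.fst) U)
    (hU0 : ∀ᵐ x, 0 ≤ U.fst x) {G I : LL n} (hw' : Sol Ω' I w')
    (hh : Sol Ω' G h) (hG : ∀ᵐ x, |G x| ≤ K * I x) :
    |L * inner ℝ U.fst h.fst - inner ℝ U.snd h.snd| ≤
      K * (L * inner ℝ U.fst w'.fst - inner ℝ U.snd w'.snd) := by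
  have hLU : ∀ᵐ x, 0 ≤ (L • U.fst : LL n) x := by
    filter_upwards [Lp.coeFn_smul L U.fst, hU0] with x h1 h2
    rw [h1]; exact mul_nonneg hL h2
  have key : ∀ s : ℝ, |s| = 1 → s * (L * inner ℝ U.fst h.fst - inner ℝ U.snd h.snd) ≤
      K * (L * inner ℝ U.fst w'.fst - inner ℝ U.snd w'.snd) := by
    intro s hs1
    have hc := hw'.comb hh K (-s)
    have hD := D_nonneg hs hm hf hP hLU (by
      filter_upwards [comb_ae I G K (-s), hG] with x h1 h2
      rw [h1]
      have : s * G x ≤ |G x| := by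
        refine (le_abs_self _).trans ?_
        rw [abs_mul, hs1, one_mul]
      linarith) hU hc
    rw [WithLp.add_fst, WithLp.add_snd, WithLp.smul_fst, WithLp.smul_snd, WithLp.smul_fst,
      WithLp.smul_snd, inner_add_right, inner_add_right, real_inner_smul_right,
      real_inner_smul_right, real_inner_smul_right, real_inner_smul_right,
      real_inner_smul_left, real_inner_smul_left] at hD
    linarith
  rw [abs_le]
  have k1 := key 1 (by simp)
  have k2 := key (-1) (by simp)
  constructor <;> linarith

set_option maxHeartbeats 1000000 in
lemma main_aux (hn : 2 ≤ n) (vmax α lam0 : ℝ) (hv : 0 < vmax) (hα : 0 < α) (hl0 : 0 < lam0) :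
    ∃ C : ℝ, 0 < C ∧ ∀ Ω Ω' : Set (Euc n), IsOpen Ω → IsOpen Ω' → Ω ⊆ Ω' →
      volume Ω' ≤ ENNReal.ofReal vmax → lam1 Ω ≤ lam0 → ∀ U U' : XX n,
      U ∈ HH Ω → ‖U.fst‖ ^ 2 = 1 → ‖U.snd‖ ^ 2 = lam1 Ω → (∀ᵐ x, 0 ≤ U.fst x) →
      U' ∈ HH Ω' → ‖U'.fst‖ ^ 2 = 1 → ‖U'.snd‖ ^ 2 = lam1 Ω' → (∀ᵐ x, 0 ≤ U'.fst x) →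
      (∀ y ∈ HH Ω', inner ℝ U'.fst y.fst = 0 → (lam1 Ω' + α) * ‖y.fst‖ ^ 2 ≤ ‖y.snd‖ ^ 2) →
      ∀ F : LL n, (∀ᵐ x, |F x| ≤ 1) → (∀ᵐ x, x ∉ Ω' → F x = 0) →
      |inner ℝ F (U'.fst - U.fst)| ≤ C * (tor Ω - tor Ω' + (lam1 Ω - lam1 Ω')) := by
  obtain ⟨C, hC, hPoin⟩ := poincare_HH hn vmax hv
  obtain ⟨K1, hK10, hK1⟩ := Linf hn vmax lam0 1 1 hv hl0.le one_pos zero_le_one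
  have hs0 := Real.sqrt_nonneg vmax
  set M1 := 1 + √vmax * K1 with hM1
  have hM10 : 0 < M1 := by positivity
  obtain ⟨K2, hK20, hK2⟩ := Linf hn vmax lam0 M1 (√vmax / α) hv hl0.le hM10 (by positivity)
  set K := lam0 * K2 + M1 with hKd
  have hK0 : 0 < K := by positivity
  refine ⟨2 * (√vmax / α) + K * (2 * lam0 * K1), by positivity, ?_⟩
  intro Ω Ω' hΩo hΩo' hs hvol hlam U U' hU h1 h2 hU0 hU' h1' h2' hU0' hgap F hF hF0
  have hf : volume Ω' ≠ ⊤ := (hvol.trans_lt ENNReal.ofReal_lt_top).ne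
  have hm := hΩo'.measurableSet
  have hP := hPoin Ω' hΩo' hvol
  have hvolΩ : volume Ω ≤ ENNReal.ofReal vmax := (measure_mono hs).trans hvol
  have hPΩ := hPoin Ω hΩo hvolΩ
  have hUS := eigen_sol hU h1 h2
  have hUS' := eigen_sol hU' h1' h2'
  have hL := lam1_nonneg Ω
  have hL' := lam1_nonneg Ω'
  have hUmem := HH_mono hs hU
  have hll : lam1 Ω' ≤ lam1 Ω := by
    have := rayleigh hUmem
    rw [h1, h2] at this; linarith
  have nU : ‖U.fst‖ = 1 := by have := norm_nonneg U.fst; nlinarith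
  have nU' : ‖U'.fst‖ = 1 := by have := norm_nonneg U'.fst; nlinarith
  have bU : ∀ᵐ x, U.fst x ≤ K1 := by
    refine hK1 Ω hΩo hvolΩ _ hL hlam _ _ hUS ?_ nU.le
    filter_upwards [Lp.coeFn_smul (lam1 Ω) U.fst] with x hx _
    rw [hx]; simp
  have bU' : ∀ᵐ x, U'.fst x ≤ K1 := by
    refine hK1 Ω' hΩo' hvol _ hL' (hll.trans hlam) _ _ hUS' ?_ nU'.le
    filter_upwards [Lp.coeFn_smul (lam1 Ω') U'.fst] with x hx _
    rw [hx]; simp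
  obtain ⟨h, hh0, hhn, hhS⟩ := exists_h hm hv.le hvol hC hP hα hL' hUS' h1' hgap hF
  have hc := inner_bound hm hv.le hvol hF hU'
  rw [nU', mul_one] at hc
  set c : ℝ := inner ℝ F U'.fst with hcd
  set G : LL n := lam1 Ω' • h.fst + (F - c • U'.fst) with hGd
  have hGae : ∀ᵐ x, G x = lam1 Ω' * h.fst x + (F x - c * U'.fst x) := by
    filter_upwards [Lp.coeFn_add (lam1 Ω' • h.fst) (F - c • U'.fst), Lp.coeFn_smul (lam1 Ω') h.fst,
      Lp.coeFn_sub F (c • U'.fst), Lp.coeFn_smul c U'.fst] with x e1 e2 e3 e4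
    rw [hGd, e1, Pi.add_apply, e2, e3, Pi.sub_apply, e4]; simp
  have hrem : ∀ᵐ x, |F x - c * U'.fst x| ≤ M1 := by
    filter_upwards [hF, bU', hU0'] with x e1 e2 e3
    refine (abs_sub _ _).trans ?_
    rw [abs_mul, abs_of_nonneg e3]
    have : |c| * U'.fst x ≤ √vmax * K1 := by gcongr
    linarith
  have bh1 : ∀ᵐ x, h.fst x ≤ K2 := by
    refine hK2 Ω' hΩo' hvol _ hL' (hll.trans hlam) _ _ hhS ?_ hhn
    filter_upwards [hGae, hrem] with x e1 e2 _
    rw [e1]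
    linarith [le_abs_self (F x - c * U'.fst x)]
  have bh2 : ∀ᵐ x, - K2 ≤ h.fst x := by
    have hS := hhS.comb hhS (-1) 0
    have := hK2 Ω' hΩo' hvol _ hL' (hll.trans hlam) _ _ hS (by
      filter_upwards [hGae, hrem, comb_ae G G (-1) 0, comb_ae h.fst h.fst (-1) 0] with x e1 e2 e3 e4 _
      rw [WithLp.add_fst, WithLp.smul_fst, WithLp.smul_fst, e3, e4, e1]
      linarith [neg_abs_le (F x - c * U'.fst x)]) (by
      rw [WithLp.add_fst, WithLp.smul_fst, WithLp.smul_fst, zero_smul, add_zero, neg_smul, one_smul,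
        norm_neg]
      exact hhn)
    filter_upwards [this, comb_ae h.fst h.fst (-1) 0] with x e1 e2
    rw [WithLp.add_fst, WithLp.smul_fst, WithLp.smul_fst, e2] at e1
    linarith
  obtain ⟨w, hw⟩ := exists_sol Ω C hC hPΩ (oneL Ω' hm hf)
  obtain ⟨w', hw'⟩ := exists_sol Ω' C hC hP (oneL Ω' hm hf)
  have hGK : ∀ᵐ x, |G x| ≤ K * oneL Ω' hm hf x := by
    filter_upwards [hGae, hrem, bh1, bh2, oneL_ae Ω' hm hf, hF0, HH_zero_off hm hhS.1,
      HH_zero_off hm hU'] with x e1 e2 e3 e4 e5 e6 e7 e8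
    rw [e1, e5]
    by_cases hx : x ∈ Ω'
    · simp only [hx, indicator_of_mem, mul_one]
      refine (abs_add_le _ _).trans ?_
      have : |lam1 Ω' * h.fst x| ≤ lam0 * K2 := by
        rw [abs_mul, abs_of_nonneg hL']
        have : |h.fst x| ≤ K2 := abs_le.2 ⟨e4, e3⟩
        have := hll.trans hlam
        gcongr
      linarith
    · simp [hx, e6 hx, e7 hx, e8 hx]
  have m1 := mu_le hs hm hf hP hL hUS hU0 hw' hhS hGK
  have m2 := mu_w_bound hs hΩo.measurableSet hm hf hC hP hL hUS bU hw hw'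
  have ht : 0 ≤ tor Ω - tor Ω' := by
    have hsub := hw'.J_le (HH_mono hs hw.1)
    rw [tor_eq hs hΩo.measurableSet hm hf hw, tor_eq le_rfl hm hm hf hw']
    unfold JJ at hsub
    rw [← real_inner_self_eq_norm_sq, ← real_inner_self_eq_norm_sq, hw.2 w hw.1,
      hw'.2 w' hw'.1] at hsub
    linarith
  have m3 : 2 * lam1 Ω * K1 * (tor Ω - tor Ω') ≤ 2 * lam0 * K1 * (tor Ω - tor Ω') := by gcongr
  have m4 : |lam1 Ω * inner ℝ U.fst h.fst - inner ℝ U.snd h.snd| ≤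
      K * (2 * lam0 * K1 * (tor Ω - tor Ω')) :=
    m1.trans (mul_le_mul_of_nonneg_left (m2.trans m3) hK0.le)
  obtain ⟨a1, a2⟩ := a_bound hα hUS' h1' hUmem h1 h2 hgap (inner_nonneg_ae hU0' hU0)
  set a : ℝ := inner ℝ U'.fst U.fst with had
  have e1 := hhS.2 U hUmem
  rw [hGd, inner_add_left, inner_sub_left, real_inner_smul_left, real_inner_smul_left, ← had,
    real_inner_comm U.fst h.fst, real_inner_comm U.snd h.snd] at e1
  have e2 : inner ℝ F (U'.fst - U.fst) = (1 - a) * c - (lam1 Ω - lam1 Ω') * inner ℝ U.fst h.fst +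
      (lam1 Ω * inner ℝ U.fst h.fst - inner ℝ U.snd h.snd) := by
    rw [inner_sub_right, ← hcd]
    linarith
  have b1 : |(1 - a) * c| ≤ (lam1 Ω - lam1 Ω') * (√vmax / α) := by
    rw [abs_mul, abs_of_nonneg a1]
    have : 1 - a ≤ (lam1 Ω - lam1 Ω') / α := by rw [le_div_iff₀ hα]; linarith
    calc (1 - a) * |c| ≤ (lam1 Ω - lam1 Ω') / α * √vmax := by gcongr
      _ = _ := by ring
  have b2 : |(lam1 Ω - lam1 Ω') * inner ℝ U.fst h.fst| ≤ (lam1 Ω - lam1 Ω') * (√vmax / α) := by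
    rw [abs_mul, abs_of_nonneg (by linarith)]
    have := abs_real_inner_le_norm U.fst h.fst
    rw [nU, one_mul] at this
    exact mul_le_mul_of_nonneg_left (this.trans hhn) (by linarith)
  rw [e2]
  refine (abs_add_le _ _).trans ((add_le_add (abs_sub _ _) m4).trans ?_)
  have p1 : 0 ≤ 2 * (√vmax / α) * (tor Ω - tor Ω') := by positivity
  have p2 : 0 ≤ K * (2 * lam0 * K1) * (lam1 Ω - lam1 Ω') :=
    mul_nonneg (by positivity) (by linarith)
  linarith


end

/-- **Key comparison estimate for eigenfunctions of nested domains.**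
Given `n ≥ 2`, `v_max, α, lam0 > 0`, there is a constant `C` such that for all nested
nonempty bounded open sets `Ω ⊆ Ω'` with `|Ω'| ≤ v_max`, `λ₁(Ω) ≤ lam0`, with `u'` a
normalized first eigenfunction of `Ω'` satisfying the spectral gap condition, `u` any
normalized first eigenfunction of `Ω`, and `f` bounded measurable, one has
`|∫ f (u' − u)| ≤ C ‖f‖_∞ (tor Ω − tor Ω' + λ₁(Ω) − λ₁(Ω'))`. -/
theorem key_comparison_estimate (n : ℕ) (hn : 2 ≤ n) (vmax α lam0 : ℝ)
    (hvmax : 0 < vmax) (hα : 0 < α) (hlam0 : 0 < lam0) :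
    ∃ C : ℝ, 0 < C ∧
      ∀ Ω Ω' : Set (Euc n), IsOpen Ω → Ω.Nonempty → IsBounded Ω →
        IsOpen Ω' → Ω'.Nonempty → IsBounded Ω' → Ω ⊆ Ω' →
        (volume Ω').toReal ≤ vmax → lam1 Ω ≤ lam0 →
        ∀ u' : Euc n → ℝ, IsEigenfun Ω' u' →
        (∀ (v : Euc n → ℝ) (Dv : Euc n → Euc n), MemH10 Ω' v Dv →
            (∫ x, v x * u' x) = 0 →
            (lam1 Ω' + α) * ∫ x, v x ^ 2 ≤ ∫ x, ‖Dv x‖ ^ 2) →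
        ∀ u : Euc n → ℝ, IsEigenfun Ω u →
        ∀ (f : Euc n → ℝ) (Mf : ℝ), Measurable f → (∀ x, |f x| ≤ Mf) →
          |∫ x, f x * (u' x - u x)| ≤
            C * Mf * (tor Ω - tor Ω' + (lam1 Ω - lam1 Ω')) := by
  obtain ⟨C, hC, hmain⟩ := main_aux hn vmax α lam0 hvmax hα hlam0
  refine ⟨C, hC, ?_⟩
  intro Ω Ω' hΩ _ _ hΩ' _ hb' hs hvol hlam u' hu' hgap u hu f Mf hfm hfM
  have hfin : volume Ω' ≠ ⊤ := hb'.measure_lt_top.ne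
  have hvol' : volume Ω' ≤ ENNReal.ofReal vmax := ENNReal.le_ofReal_iff_toReal_le hfin hvmax.le |>.2 hvol
  have hM0 : 0 ≤ Mf := (abs_nonneg _).trans (hfM 0)
  rcases hM0.eq_or_lt with hM | hM
  · have : ∀ x, f x = 0 := fun x => by
      have := hfM x
      rw [← hM] at this
      exact abs_nonpos_iff.1 this
    simp [this, ← hM]
  obtain ⟨hu0, huz, hu1, Du, hDu, hlu⟩ := hu
  obtain ⟨hu0', huz', hu1', Du', hDu', hlu'⟩ := hu'
  have hF2 : MemLp (Ω'.indicator fun x => f x / Mf) 2 volume := by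
    have h1 : MemLp (Ω'.indicator fun _ => (1:ℝ)) 2 volume :=
      memLp_indicator_const 2 hΩ'.measurableSet 1 (Or.inr hfin)
    refine h1.of_le ((hfm.div_const _).indicator hΩ'.measurableSet).aestronglyMeasurable
      (Eventually.of_forall fun x => ?_)
    by_cases hx : x ∈ Ω'
    · simp only [hx, indicator_of_mem, norm_div, Real.norm_eq_abs, abs_of_pos hM, abs_one]
      exact (div_le_one hM).2 (hfM x)
    · simp [hx]
  have eU : ∀ᵐ x, (mkX u Du hDu.1 hDu.2.1).fst x = u x := hDu.1.coeFn_toLp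
  have eU' : ∀ᵐ x, (mkX u' Du' hDu'.1 hDu'.2.1).fst x = u' x := hDu'.1.coeFn_toLp
  have key := hmain Ω Ω' hΩ hΩ' hs hvol' hlam (mkX u Du hDu.1 hDu.2.1) (mkX u' Du' hDu'.1 hDu'.2.1)
    (mkX_mem hDu) ((norm_toLp_sq hDu.1).trans (by simpa using hu1))
    ((norm_toLp_sq hDu.2.1).trans hlu)
    (by filter_upwards [eU, hu0] with x h1 h2; rwa [h1])
    (mkX_mem hDu') ((norm_toLp_sq hDu'.1).trans (by simpa using hu1'))
    ((norm_toLp_sq hDu'.2.1).trans hlu')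
    (by filter_upwards [eU', hu0'] with x h1 h2; rwa [h1])
    (by
      intro y hy h0
      have := hgap y.fst y.snd (HH_memH10 hy) (by
        rw [real_inner_eq] at h0
        rw [← h0]
        refine integral_congr_ae ?_
        filter_upwards [eU'] with x hx
        rw [hx, mul_comm])
      rw [norm_Lp_sq, norm_Lp_sq]
      simpa using this)
    (hF2.toLp _)
    (by
      filter_upwards [hF2.coeFn_toLp] with x hx
      rw [hx]
      by_cases hx : x ∈ Ω'
      · simp only [hx, indicator_of_mem, abs_div, abs_of_pos hM]
        exact (div_le_one hM).2 (hfM x)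
      · simp [hx])
    (by
      filter_upwards [hF2.coeFn_toLp] with x hx h
      rw [hx]; simp [h])
  have e : ∫ x, f x * (u' x - u x) = Mf * inner ℝ (hF2.toLp _)
      ((mkX u' Du' hDu'.1 hDu'.2.1).fst - (mkX u Du hDu.1 hDu.2.1).fst) := by
    rw [real_inner_eq, ← integral_const_mul]
    refine integral_congr_ae ?_
    filter_upwards [hF2.coeFn_toLp, eU, eU', Lp.coeFn_sub (mkX u' Du' hDu'.1 hDu'.2.1).fst
      (mkX u Du hDu.1 hDu.2.1).fst] with x h1 h2 h3 h4
    rw [h4, Pi.sub_apply, h1, h2, h3]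
    by_cases hx : x ∈ Ω'
    · simp only [hx, indicator_of_mem]
      field_simp
    · simp [huz' x hx, huz x (fun h => hx (hs h))]
  rw [e, abs_mul, abs_of_pos hM]
  calc _ ≤ _ := mul_le_mul_of_nonneg_left key hM.le
    _ = _ := by ring
end
end

section
/- Torsional rigidity lower bound in terms of volume: For every n ≥ 3 there is a constant C(n) such that for every nonempty bounded open set Ω ⊆ ℝ^n, tor(Ω) ≥ −C(n)·|Ω|^{(n+2)/n}; equivalently, for every w ∈ H¹₀(Ω) one has ∫ (½|∇w|² − w) ≥ −C(n)·|Ω|^{(n+2)/n}. -/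
open MeasureTheory Metric Set Filter Bornology
open scoped ENNReal NNReal Topology

noncomputable section

/-- The torsion function of `Ω` (the minimizer of the torsion energy),
extended by zero outside `Ω`. -/
def IsTorsionFun {n : ℕ} (Ω : Set (Euc n)) (w : Euc n → ℝ) : Prop :=
  (∀ x ∉ Ω, w x = 0) ∧
  ∃ Dw, MemH10 Ω w Dw ∧ (∫ x, ((1 / 2) * ‖Dw x‖ ^ 2 - w x)) = tor Ω

lemma aux_tendsto {n : ℕ} {F : Type*} [NormedAddCommGroup F] (f : ℕ → Euc n → F)
    (hf : ∀ k, MemLp (f k) 2 volume)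
    (h : Tendsto (fun k => ∫ x, ‖f k x‖ ^ 2) atTop (𝓝 0)) :
    Tendsto (fun k => eLpNorm (f k) 2 volume) atTop (𝓝 0) := by
  have h1 : (fun k => eLpNorm (f k) 2 volume) =
      fun k => ENNReal.ofReal ((∫ x, ‖f k x‖ ^ 2) ^ (2⁻¹ : ℝ)) := by
    funext k
    rw [(hf k).eLpNorm_eq_integral_rpow_norm (by norm_num) (by norm_num)]
    simp
  rw [h1]
  have h2 := h.rpow_const (p := (2⁻¹ : ℝ)) (Or.inr (by norm_num))
  have h3 := ENNReal.tendsto_ofReal h2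
  simpa using h3

lemma aux_norm_grad {n : ℕ} (φ : Euc n → ℝ) (x : Euc n) :
    ‖gradient φ x‖ = ‖fderiv ℝ φ x‖ := by
  simp [gradient]

lemma aux_grad_memLp {n : ℕ} {Ω : Set (Euc n)} {φ : Euc n → ℝ} (h : IsTestFun Ω φ) :
    MemLp (gradient φ) 2 volume := by
  have hc : Continuous (fderiv ℝ φ) := h.1.continuous_fderiv (by simp)
  have h1 : MemLp (fderiv ℝ φ) 2 (volume : Measure (Euc n)) :=
    hc.memLp_of_hasCompactSupport (h.2.1.fderiv ℝ)
  refine h1.of_le ?_ (Eventually.of_forall fun x => (aux_norm_grad φ x).le)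
  have : Continuous (gradient φ) :=
    (InnerProductSpace.toDual ℝ (Euc n)).symm.continuous.comp hc
  exact this.aestronglyMeasurable

lemma aux_sobolev (n : ℕ) (hn : 3 ≤ n) : ∃ S : ℝ≥0, ∀ (Ω : Set (Euc n)) (φ : Euc n → ℝ),
    IsTestFun Ω φ → eLpNorm φ 1 (volume.restrict Ω) ≤
      S * volume Ω ^ ((1:ℝ) / 2 + 1 / n) * eLpNorm (gradient φ) 2 volume := by
  refine ⟨SNormLESNormFDerivOfEqConst ℝ (volume : Measure (Euc n)) 2, fun Ω φ h => ?_⟩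
  have hn' : (3:ℝ) ≤ n := by exact_mod_cast hn
  have hpos : (0:ℝ) < 1 / 2 - 1 / n := by
    have : (1:ℝ) / n ≤ 1 / 3 := by gcongr
    linarith
  set p' : ℝ≥0 := Real.toNNReal (((1:ℝ) / 2 - 1 / n)⁻¹) with hp'
  have hp'c : (p' : ℝ) = ((1:ℝ) / 2 - 1 / n)⁻¹ := Real.coe_toNNReal _ (by positivity)
  have hu : ContDiff ℝ 1 φ := h.1.of_le (by simp)
  have h1 : eLpNorm φ p' volume ≤ SNormLESNormFDerivOfEqConst ℝ (volume : Measure (Euc n)) 2 *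
      eLpNorm (fderiv ℝ φ) (2 : ℝ≥0) volume := by
    refine eLpNorm_le_eLpNorm_fderiv_of_eq (p := 2) volume hu h.2.1 (by norm_num)
      (by simp; omega) ?_
    rw [hp'c]; simp
  have h2 : eLpNorm (fderiv ℝ φ) (2 : ℝ≥0) volume = eLpNorm (gradient φ) 2 volume := by
    apply eLpNorm_congr_norm_ae
    exact Eventually.of_forall fun x => (aux_norm_grad φ x).symm
  have h3 : (1 : ℝ≥0∞) ≤ p' := by
    have : (1:ℝ) ≤ p' := by
      rw [hp'c]
      refine (one_le_inv₀ hpos).2 ?_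
      have : (0:ℝ) ≤ 1 / n := by positivity
      linarith
    exact_mod_cast this
  have h4 := eLpNorm_le_eLpNorm_mul_rpow_measure_univ (μ := volume.restrict Ω) h3
    h.1.continuous.aestronglyMeasurable
  have h5 : 1 / (1 : ℝ≥0∞).toReal - 1 / (p' : ℝ≥0∞).toReal = (1:ℝ) / 2 + 1 / n := by
    simp only [ENNReal.toReal_one, ENNReal.coe_toReal, hp'c, one_div, inv_inv]
    ring
  rw [h5, Measure.restrict_apply_univ] at h4
  calc _ ≤ _ := h4
    _ ≤ eLpNorm φ p' volume * volume Ω ^ ((1:ℝ) / 2 + 1 / n) := by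
      gcongr
      exact Measure.restrict_le_self
    _ ≤ (SNormLESNormFDerivOfEqConst ℝ (volume : Measure (Euc n)) 2 *
      eLpNorm (gradient φ) 2 volume) * volume Ω ^ ((1:ℝ) / 2 + 1 / n) := by
      rw [h2] at h1
      gcongr
    _ = _ := by ring

lemma aux_H10 (n : ℕ) (S : ℝ≥0) (hS : ∀ (Ω : Set (Euc n)) (φ : Euc n → ℝ),
    IsTestFun Ω φ → eLpNorm φ 1 (volume.restrict Ω) ≤
      S * volume Ω ^ ((1:ℝ) / 2 + 1 / n) * eLpNorm (gradient φ) 2 volume)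
    (Ω : Set (Euc n)) (ho : IsOpen Ω) (hb : IsBounded Ω) (w : Euc n → ℝ) (Dw : Euc n → Euc n)
    (h : MemH10 Ω w Dw) :
    eLpNorm w 1 volume ≤ S * volume Ω ^ ((1:ℝ) / 2 + 1 / n) * eLpNorm Dw 2 volume := by
  obtain ⟨hw, hD, φ, hφ, t1, t2⟩ := h
  have hV : volume Ω ≠ ∞ := hb.measure_lt_top.ne
  have m1 : ∀ k, MemLp (fun x => φ k x - w x) 2 volume := fun k =>
    ((hφ k).1.continuous.memLp_of_hasCompactSupport (hφ k).2.1).sub hw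
  have m2 : ∀ k, MemLp (fun x => gradient (φ k) x - Dw x) 2 volume := fun k =>
    (aux_grad_memLp (hφ k)).sub hD
  have e1 := aux_tendsto _ m1 (by simpa using t1)
  have e2 := aux_tendsto _ m2 t2
  -- vanishing outside
  have z : eLpNorm w 2 (volume.restrict Ωᶜ) = 0 := by
    refine le_antisymm (ge_of_tendsto' e1 fun k => ?_) zero_le
    calc eLpNorm w 2 (volume.restrict Ωᶜ)
        = eLpNorm (fun x => φ k x - w x) 2 (volume.restrict Ωᶜ) := by
          apply eLpNorm_congr_norm_ae
          filter_upwards [ae_restrict_mem ho.measurableSet.compl] with x hx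
          have : φ k x = 0 := by
            by_contra hne
            exact hx ((hφ k).2.2 (subset_tsupport _ hne))
          simp [this]
      _ ≤ _ := eLpNorm_mono_measure _ Measure.restrict_le_self
  have z' : w =ᵐ[volume.restrict Ωᶜ] 0 :=
    (eLpNorm_eq_zero_iff hw.1.restrict (by norm_num)).1 z
  have z1 : eLpNorm w 1 volume = eLpNorm w 1 (volume.restrict Ω) := by
    rw [eLpNorm_one_eq_lintegral_enorm, eLpNorm_one_eq_lintegral_enorm,
      ← lintegral_add_compl _ ho.measurableSet]
    have : ∫⁻ x in Ωᶜ, ‖w x‖ₑ = 0 := by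
      rw [lintegral_congr_ae (g := fun _ => 0)]
      · simp
      · filter_upwards [z'] with x hx
        simp [hx]
    rw [this, add_zero]
  rw [z1]
  set K : ℝ≥0∞ := S * volume Ω ^ ((1:ℝ) / 2 + 1 / n) with hK
  have hKt : K ≠ ∞ :=
    ENNReal.mul_ne_top ENNReal.coe_ne_top (ENNReal.rpow_ne_top_of_nonneg (by positivity) hV)
  set L : ℝ≥0∞ := volume Ω ^ ((1:ℝ) / 2) with hL
  have hLt : L ≠ ∞ := ENNReal.rpow_ne_top_of_nonneg (by positivity) hV
  have T : Tendsto (fun k => K * (eLpNorm Dw 2 volume +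
      eLpNorm (fun x => gradient (φ k) x - Dw x) 2 volume) +
      eLpNorm (fun x => φ k x - w x) 2 volume * L) atTop
      (𝓝 (K * (eLpNorm Dw 2 volume + 0) + 0 * L)) := by
    refine Tendsto.add (ENNReal.Tendsto.const_mul (tendsto_const_nhds.add e2) (Or.inr hKt))
      (ENNReal.Tendsto.mul_const e1 (Or.inr hLt))
  rw [add_zero, zero_mul, add_zero] at T
  refine ge_of_tendsto' T fun k => ?_
  have hφm : AEStronglyMeasurable (φ k) (volume.restrict Ω) :=
    (hφ k).1.continuous.aestronglyMeasurable
  have a1 : eLpNorm w 1 (volume.restrict Ω) ≤ eLpNorm (φ k) 1 (volume.restrict Ω) +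
      eLpNorm (fun x => φ k x - w x) 1 (volume.restrict Ω) := by
    have := eLpNorm_sub_le (p := 1) hφm (m1 k).1.restrict le_rfl (μ := volume.restrict Ω)
    convert this using 2
    funext x; simp
  have a2 : eLpNorm (fun x => φ k x - w x) 1 (volume.restrict Ω) ≤
      eLpNorm (fun x => φ k x - w x) 2 volume * L := by
    have := eLpNorm_le_eLpNorm_mul_rpow_measure_univ (μ := volume.restrict Ω)
      (p := 1) (q := 2) (by norm_num) (m1 k).1.restrict
    rw [Measure.restrict_apply_univ] at this
    have e : 1 / (1 : ℝ≥0∞).toReal - 1 / (2 : ℝ≥0∞).toReal = (1:ℝ) / 2 := by norm_num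
    rw [e] at this
    refine this.trans ?_
    gcongr
    exact Measure.restrict_le_self
  have a3 : eLpNorm (gradient (φ k)) 2 volume ≤ eLpNorm Dw 2 volume +
      eLpNorm (fun x => gradient (φ k) x - Dw x) 2 volume := by
    have := eLpNorm_add_le (p := 2) hD.1 (m2 k).1 (by norm_num)
    convert this using 2
    funext x; simp
  calc _ ≤ _ := a1
    _ ≤ _ := add_le_add ((hS Ω (φ k) (hφ k)).trans (mul_le_mul_right a3 K)) a2

lemma aux_energy (n : ℕ) (hn : 3 ≤ n) (S : ℝ≥0) (Ω : Set (Euc n)) (hb : IsBounded Ω)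
    (w : Euc n → ℝ) (Dw : Euc n → Euc n) (hw : MemLp w 2 volume) (hD : MemLp Dw 2 volume)
    (h : eLpNorm w 1 volume ≤ S * volume Ω ^ ((1:ℝ) / 2 + 1 / n) * eLpNorm Dw 2 volume) :
    -((S:ℝ) ^ 2 / 2 + 1) * (volume Ω).toReal ^ (((n : ℝ) + 2) / n) ≤
            ∫ x, ((1 / 2) * ‖Dw x‖ ^ 2 - w x) := by
  have hn' : (0:ℝ) < n := by exact_mod_cast (by omega : 0 < n)
  have hV : volume Ω ≠ ∞ := hb.measure_lt_top.ne
  have hKt : (S * volume Ω ^ ((1:ℝ) / 2 + 1 / n) : ℝ≥0∞) ≠ ∞ :=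
    ENNReal.mul_ne_top ENNReal.coe_ne_top (ENNReal.rpow_ne_top_of_nonneg (by positivity) hV)
  have hfin := ENNReal.mul_ne_top hKt hD.2.ne
  have hwi : Integrable w := memLp_one_iff_integrable.1 ⟨hw.1, h.trans_lt hfin.lt_top⟩
  have hDi : Integrable (fun x => ‖Dw x‖ ^ 2) := by
    simpa using hD.integrable_norm_pow (by norm_num)
  have hr := ENNReal.toReal_mono hfin h
  rw [ENNReal.toReal_mul, ENNReal.toReal_mul, ← ENNReal.toReal_rpow, ENNReal.coe_toReal] at hr
  have hw1 : ∫ x, w x ≤ (eLpNorm w 1 volume).toReal := by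
    rw [eLpNorm_one_eq_lintegral_enorm, ← integral_norm_eq_lintegral_enorm hw.1]
    exact integral_mono hwi hwi.norm fun x => le_abs_self _
  have hD2 : ∫ x, ‖Dw x‖ ^ 2 = (eLpNorm Dw 2 volume).toReal ^ 2 := by
    rw [hD.eLpNorm_eq_integral_rpow_norm (by norm_num) (by norm_num)]
    have h0 : 0 ≤ ∫ x, ‖Dw x‖ ^ 2 := integral_nonneg fun x => by positivity
    rw [ENNReal.toReal_ofReal (by positivity)]
    simp only [ENNReal.toReal_ofNat, Real.rpow_two]
    rw [← Real.rpow_natCast, ← Real.rpow_mul h0]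
    norm_num
  rw [integral_sub (hDi.const_mul _) hwi, integral_const_mul, hD2]
  have hv : (volume Ω).toReal ^ (((n : ℝ) + 2) / n) =
      ((volume Ω).toReal ^ ((1:ℝ) / 2 + 1 / n)) ^ 2 := by
    rw [← Real.rpow_natCast, ← Real.rpow_mul ENNReal.toReal_nonneg]
    congr 1
    push_cast
    field_simp
  rw [hv]
  set V := (volume Ω).toReal ^ ((1:ℝ) / 2 + 1 / n)
  set a := (eLpNorm Dw 2 volume).toReal
  nlinarith [sq_nonneg (a - S * V), sq_nonneg V]

/-- **Torsional rigidity lower bound in terms of volume.** For every `n ≥ 3` there is a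
constant `C(n)` such that for every nonempty bounded open `Ω ⊆ ℝⁿ`,
`tor Ω ≥ −C(n)·|Ω|^{(n+2)/n}`; equivalently, every `w ∈ H¹₀(Ω)` satisfies
`∫ (½|∇w|² − w) ≥ −C(n)·|Ω|^{(n+2)/n}`. -/
theorem torsion_lower_bound (n : ℕ) (hn : 3 ≤ n) :
    ∃ C : ℝ, 0 < C ∧
      ∀ Ω : Set (Euc n), IsOpen Ω → Ω.Nonempty → IsBounded Ω →
        (-C * (volume Ω).toReal ^ (((n : ℝ) + 2) / n) ≤ tor Ω) ∧
        ∀ w Dw, MemH10 Ω w Dw →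
          -C * (volume Ω).toReal ^ (((n : ℝ) + 2) / n) ≤
            ∫ x, ((1 / 2) * ‖Dw x‖ ^ 2 - w x) := by
  obtain ⟨S, hS⟩ := aux_sobolev n hn
  refine ⟨(S:ℝ) ^ 2 / 2 + 1, by positivity, fun Ω ho _ hb => ?_⟩
  have key : ∀ w Dw, MemH10 Ω w Dw →
      -((S:ℝ) ^ 2 / 2 + 1) * (volume Ω).toReal ^ (((n : ℝ) + 2) / n) ≤
            ∫ x, ((1 / 2) * ‖Dw x‖ ^ 2 - w x) := fun w Dw h =>
    aux_energy n hn S Ω hb w Dw h.1 h.2.1 (aux_H10 n S hS Ω ho hb w Dw h)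
  refine ⟨?_, key⟩
  refine le_csInf ?_ ?_
  · refine ⟨_, 0, 0, ⟨MemLp.zero, MemLp.zero, fun _ => 0, fun k => ?_, ?_, ?_⟩, rfl⟩
    · refine ⟨contDiff_const, HasCompactSupport.zero, ?_⟩
      have : tsupport (0 : Euc n → ℝ) = ∅ := tsupport_eq_empty_iff.2 rfl
      rw [this]; exact empty_subset _
    · simp
    · have : ∀ x, gradient (0 : Euc n → ℝ) x = 0 := fun x => by simp [gradient]
      simp [this]
  · rintro r ⟨w, Dw, h, rfl⟩
    exact key w Dw h
end
end
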